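/- arXiv:0902.3637 — 5 statements merged into one kernel-verified Lean document; each statement's English description precedes it below -/
import Mathlib

section
/- Let M be a 01-filling of a moon polyomino 𝓜 with columns c_1,…,c_m, ordered c_{i_1}≺c_{i_2}≺⋯≺c_{i_m} by the total order ≺, and let M_j denote the restriction of M to the rectangle 𝓜(c_{i_j}) for 1≤j≤m. Then the two definitions of the major index agree: maj(M) = Σ_{j=1}^{m} maj(M_j) − Σ_{j=1}^{m−1} maj(M_j ∩ M_{j+1}), where maj(M) is computed via the maximal rectangles of 𝓜. -/
open Polynomial

namespace MoonPolyomino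

/-- A cell `(r, c)` of `ℤ²`: `r` is the row index (rows increase downwards)
and `c` is the column index (columns increase to the right). -/
abbrev Cell : Type := ℤ × ℤ

/-- The set of (indices of) rows of a polyomino. -/
def rowSet (P : Finset Cell) : Finset ℤ := P.image Prod.fst

/-- The set of (indices of) columns of a polyomino. -/
def colSet (P : Finset Cell) : Finset ℤ := P.image Prod.snd

/-- The length of row `r` of `P`. -/
def rowLen (P : Finset Cell) (r : ℤ) : ℕ := (P.filter fun x => x.1 = r).card

/-- The length of column `c` of `P`. -/
def colLen (P : Finset Cell) (c : ℤ) : ℕ := (P.filter fun x => x.2 = c).card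

def RowConvex (P : Finset Cell) : Prop :=
  ∀ r c₁ c₂ c : ℤ, (r, c₁) ∈ P → (r, c₂) ∈ P → c₁ ≤ c → c ≤ c₂ → (r, c) ∈ P

def ColConvex (P : Finset Cell) : Prop :=
  ∀ c r₁ r₂ r : ℤ, (r₁, c) ∈ P → (r₂, c) ∈ P → r₁ ≤ r → r ≤ r₂ → (r, c) ∈ P

/-- Any two columns are comparable (the rows met by one form a subset of those met
by the other). -/
def IntersectionFree (P : Finset Cell) : Prop :=
  ∀ c₁ c₂ : ℤ, (∀ r : ℤ, (r, c₁) ∈ P → (r, c₂) ∈ P) ∨ (∀ r : ℤ, (r, c₂) ∈ P → (r, c₁) ∈ P)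

/-- A moon polyomino: a convex intersection-free polyomino. -/
def IsMoon (P : Finset Cell) : Prop := RowConvex P ∧ ColConvex P ∧ IntersectionFree P

/-- A left-aligned stack polyomino: all rows have their leftmost cell in the same column. -/
def LeftAligned (P : Finset Cell) : Prop := ∃ c₀ : ℤ, ∀ x ∈ P, c₀ ≤ x.2 ∧ (x.1, c₀) ∈ P

/-- A top-aligned stack polyomino: all columns have their topmost cell in the same row. -/
def TopAligned (P : Finset Cell) : Prop := ∃ r₀ : ℤ, ∀ x ∈ P, r₀ ≤ x.1 ∧ (r₀, x.2) ∈ P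

/-- A 01-filling of `P`, identified with its set `M` of 1-cells: at most one 1 in each row. -/
def IsFilling (P M : Finset Cell) : Prop :=
  M ⊆ P ∧ ∀ x ∈ M, ∀ y ∈ M, x.1 = y.1 → x = y

open scoped Classical in
/-- `F(𝓜, s; A)`: the 01-fillings of `P` in which column `c` contains exactly `s c` ones
and whose empty rows are exactly the rows in `A`. -/
noncomputable def FillSet (P : Finset Cell) (s : ℤ → ℕ) (A : Finset ℤ) :
    Finset (Finset Cell) :=
  P.powerset.filter fun M =>
    (∀ x ∈ M, ∀ y ∈ M, x.1 = y.1 → x = y) ∧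
    (∀ c ∈ colSet P, (M.filter fun x => x.2 = c).card = s c) ∧
    (∀ r ∈ rowSet P, (r ∈ A ↔ ∀ x ∈ M, x.1 ≠ r))

open scoped Classical in
/-- `ne(M)`: the number of north-east chains, i.e. pairs of 1-cells, one strictly above and
strictly to the right of the other, such that the smallest rectangle containing both lies
in `P`.  In a pair `p`, `p.1` is the lower-left cell and `p.2` the upper-right one. -/
noncomputable def neP (P M : Finset Cell) : ℕ :=
  ((M ×ˢ M).filter fun p =>
      p.2.1 < p.1.1 ∧ p.1.2 < p.2.2 ∧
      ∀ a b : ℤ, p.2.1 ≤ a → a ≤ p.1.1 → p.1.2 ≤ b → b ≤ p.2.2 → (a, b) ∈ P).card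

open scoped Classical in
/-- The descent statistic of a rectangular filling `M`: the number of pairs of 1-cells lying
in consecutive nonempty rows and forming a north-east chain (`p.1` is the cell in the upper
of the two rows, `p.2` the one in the next nonempty row below it). -/
noncomputable def desR (M : Finset Cell) : ℕ :=
  ((M ×ˢ M).filter fun p =>
      p.1.1 < p.2.1 ∧ p.2.2 < p.1.2 ∧ ∀ z ∈ M, ¬ (p.1.1 < z.1 ∧ z.1 < p.2.1)).card

/-- The major index of a rectangular filling `M`: the sum, over the nonempty rows `r`,
of the descent statistic of the restriction of `M` to row `r` and the rows above it. -/
noncomputable def majR (M : Finset Cell) : ℕ :=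
  ∑ y ∈ M, desR (M.filter fun x => x.1 ≤ y.1)

/-- `R` is a (nonempty) combinatorial rectangle. -/
def IsRect (R : Finset Cell) : Prop :=
  ∃ r₁ r₂ c₁ c₂ : ℤ, r₁ ≤ r₂ ∧ c₁ ≤ c₂ ∧ R = Finset.Icc r₁ r₂ ×ˢ Finset.Icc c₁ c₂

/-- `R` is a maximal rectangle contained in `P`. -/
def IsMaxRect (P R : Finset Cell) : Prop :=
  IsRect R ∧ R ⊆ P ∧ ∀ R' : Finset Cell, IsRect R' → R' ⊆ P → R ⊆ R' → R' = R

open scoped Classical in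
/-- The set of maximal rectangles contained in `P`. -/
noncomputable def maxRects (P : Finset Cell) : Finset (Finset Cell) :=
  P.powerset.filter fun R => IsMaxRect P R

/-- The height (number of rows) of a rectangle. -/
def nRows (R : Finset Cell) : ℕ := (R.image Prod.fst).card

open scoped Classical in
/-- The major index of a filling `M` of a moon polyomino `P`:
`maj(M) = Σᵢ maj(Rᵢ) − Σᵢ maj(Rᵢ ∩ Rᵢ₊₁)`, where `R₁, …, R_r` are the restrictions of `M`
to the maximal rectangles of `P` listed in increasing order of height (in a moon polyomino
the maximal rectangles have pairwise distinct heights; the consecutive pairs are exactly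
the pairs of maximal rectangles with no maximal rectangle of intermediate height). -/
noncomputable def majP (P M : Finset Cell) : ℕ :=
  (∑ R ∈ maxRects P, majR (M ∩ R)) -
    ∑ p ∈ (maxRects P ×ˢ maxRects P).filter
        (fun p => nRows p.1 < nRows p.2 ∧
          ∀ T ∈ maxRects P, ¬ (nRows p.1 < nRows T ∧ nRows T < nRows p.2)),
      majR (M ∩ p.1 ∩ p.2)

/-- `c` belongs to the right part `Right(𝓜)` of `P`: every column strictly to its right
is at most as long as `c`. -/
def InRightPart (P : Finset Cell) (c : ℤ) : Prop :=
  ∀ d ∈ colSet P, c < d → colLen P d ≤ colLen P c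

/-- The total order `≺` on the columns of a moon polyomino. -/
def colPrec (P : Finset Cell) (c d : ℤ) : Prop :=
  colLen P c < colLen P d ∨
    (colLen P c = colLen P d ∧
      ((¬ InRightPart P c ∧ InRightPart P d) ∨
       (¬ InRightPart P c ∧ ¬ InRightPart P d ∧ c < d) ∨
       (InRightPart P c ∧ InRightPart P d ∧ d < c)))

open scoped Classical in
/-- `h_c = |c| − a_c − Σ_{d ≺ c} s_d`, where `a_c` is the number of rows of `A`
meeting column `c`. -/
noncomputable def hVal (P : Finset Cell) (s : ℤ → ℕ) (A : Finset ℤ) (c : ℤ) : ℤ :=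
  (colLen P c : ℤ) - ((A.filter fun r => (r, c) ∈ P).card : ℤ)
    - ∑ d ∈ (colSet P).filter (fun d => colPrec P d c), (s d : ℤ)

open scoped Classical in
/-- The Gaussian binomial coefficient
`[h choose s]_q = Σ_{0 ≤ i₁ ≤ ⋯ ≤ i_s ≤ h−s} q^{i₁+⋯+i_s}` as a polynomial in `q = X`. -/
noncomputable def gaussBinom (h : ℤ) (s : ℕ) : Polynomial ℤ :=
  ∑ f ∈ (Fintype.piFinset fun _ : Fin s => Finset.Icc (0 : ℤ) (h - s)).filter
      (fun f => Monotone f),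
    Polynomial.X ^ (∑ i, f i).toNat

/-- The major index of a word: `maj(w) = Σ_{i ∈ Des(w)} i` (positions are 1-based). -/
def majW (w : List ℕ) : ℕ :=
  ∑ i ∈ Finset.range (w.length - 1), if w.getD (i + 1) 0 < w.getD i 0 then i + 1 else 0

/-- The descent number of a word. -/
def desW (w : List ℕ) : ℕ :=
  ∑ i ∈ Finset.range (w.length - 1), if w.getD (i + 1) 0 < w.getD i 0 then 1 else 0

/-- `w'` is obtained from `w` by inserting `m` copies of the letter `a` (where `a` does not
occur in `w`): `w'` has length `k + m`, exactly `m` letters equal to `a`, and its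
subsequence of letters different from `a` is `w`. -/
def IsInsertion (w : List ℕ) (a m : ℕ) (w' : List ℕ) : Prop :=
  w'.length = w.length + m ∧ w'.count a = m ∧ w'.filter (fun x => decide (x ≠ a)) = w

open scoped Classical in
/-- The weakly increasing `m`-tuples `0 ≤ i₁ ≤ ⋯ ≤ i_m ≤ k`. -/
noncomputable def monoTuples (m k : ℕ) : Finset (Fin m → ℕ) :=
  (Fintype.piFinset fun _ : Fin m => Finset.range (k + 1)).filter fun f => Monotone f


open scoped Classical in
/-- For `c` in the left part of `P`: the largest rectangle contained in `P` having
(the whole column) `c` as its leftmost column. -/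
noncomputable def MrectLeft (P : Finset Cell) (c : ℤ) : Finset Cell :=
  P.filter fun x => c ≤ x.2 ∧ (x.1, c) ∈ P ∧ ∀ r : ℤ, (r, c) ∈ P → (r, x.2) ∈ P

open scoped Classical in
/-- For `c` in the right part of `P`: the largest rectangle contained in `P` having `c` as
its rightmost column and containing no column of the left part of the same length as `c`. -/
noncomputable def MrectRight (P : Finset Cell) (c : ℤ) : Finset Cell :=
  P.filter fun x => x.2 ≤ c ∧ (x.1, c) ∈ P ∧ (∀ r : ℤ, (r, c) ∈ P → (r, x.2) ∈ P) ∧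
    ¬ (¬ InRightPart P x.2 ∧ colLen P x.2 = colLen P c)

open scoped Classical in
/-- The rectangle `𝓜(c)` associated to a column `c` of a moon polyomino. -/
noncomputable def Mrect (P : Finset Cell) (c : ℤ) : Finset Cell :=
  if InRightPart P c then MrectRight P c else MrectLeft P c

section Helpers

theorem colPrec_trans {P : Finset Cell} {a b c : ℤ} (h1 : colPrec P a b) (h2 : colPrec P b c) :
    colPrec P a c := by
  unfold colPrec at *
  grind

theorem colPrec_len {P : Finset Cell} {a b : ℤ} (h1 : colPrec P a b) :
    colLen P a ≤ colLen P b := by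
  unfold colPrec at *
  omega

theorem colLen_eq (P : Finset Cell) (c : ℤ) :
    colLen P c = ((P.filter fun x => x.2 = c).image Prod.fst).card := by
  unfold colLen
  rw [Finset.card_image_of_injOn]
  rintro ⟨a, b⟩ h ⟨a', b'⟩ h' e
  simp at h h' e
  grind

theorem mem_col (P : Finset Cell) (c r : ℤ) :
    r ∈ ((P.filter fun x => x.2 = c).image Prod.fst) ↔ (r, c) ∈ P := by
  simp

theorem colLen_mono {P : Finset Cell} {c x : ℤ} (h : ∀ r, (r, c) ∈ P → (r, x) ∈ P) :
    colLen P c ≤ colLen P x := by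
  rw [colLen_eq, colLen_eq]
  apply Finset.card_le_card
  intro r hr
  rw [mem_col] at *
  exact h r hr

theorem colLen_le_iff {P : Finset Cell} (hP : IsMoon P) (c x : ℤ) :
    colLen P c ≤ colLen P x ↔ ∀ r, (r, c) ∈ P → (r, x) ∈ P := by
  refine ⟨fun h => ?_, colLen_mono⟩
  rcases hP.2.2 c x with h1 | h1
  · exact h1
  · rw [colLen_eq, colLen_eq] at h
    have := Finset.eq_of_subset_of_card_le (s := ((P.filter fun y => y.2 = x).image Prod.fst))
      (t := ((P.filter fun y => y.2 = c).image Prod.fst)) (by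
        intro r hr
        rw [mem_col] at *
        exact h1 r hr) h
    intro r hr
    rw [← mem_col] at *
    rw [this]; exact hr

/-- unimodality -/
theorem colLen_between {P : Finset Cell} (hP : IsMoon P) {a b c x : ℤ} (h1 : a ≤ x) (h2 : x ≤ b)
    (ha : colLen P c ≤ colLen P a) (hb : colLen P c ≤ colLen P b) : colLen P c ≤ colLen P x := by
  rw [colLen_le_iff hP] at *
  intro r hr
  exact hP.1 r a b x (ha r hr) (hb r hr) h1 h2

theorem mem_colSet {P : Finset Cell} {c : ℤ} : c ∈ colSet P ↔ ∃ r, (r, c) ∈ P := by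
  simp [colSet]

theorem mem_Mrect {P : Finset Cell} (hP : IsMoon P) {c : ℤ} (x : Cell) :
    x ∈ Mrect P c ↔ x ∈ P ∧ (x.1, c) ∈ P ∧ (x.2 = c ∨ colPrec P c x.2) := by
  classical
  unfold Mrect
  split_ifs with hR
  · unfold MrectRight
    simp only [Finset.mem_filter]
    rw [← colLen_le_iff hP]
    constructor
    · rintro ⟨h1, h2, h3, h4, h5⟩
      refine ⟨h1, h3, ?_⟩
      unfold colPrec
      grind
    · rintro ⟨h1, h2, h3⟩
      have hx : x.2 ∈ colSet P := mem_colSet.2 ⟨x.1, h1⟩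
      refine ⟨h1, ?_⟩
      have h6 := hR x.2 hx
      unfold colPrec at h3
      grind
  · unfold MrectLeft
    simp only [Finset.mem_filter]
    rw [← colLen_le_iff hP]
    constructor
    · rintro ⟨h1, h2, h3, h4⟩
      refine ⟨h1, h3, ?_⟩
      unfold colPrec
      grind
    · rintro ⟨h1, h2, h3⟩
      have hR' := hR
      unfold InRightPart at hR'
      push Not at hR'
      obtain ⟨d, hd, hcd, hl⟩ := hR'
      refine ⟨h1, ?_, h2, ?_⟩
      · by_contra hlt
        push Not at hlt
        rcases h3 with h3 | h3 | ⟨h3, h4 | h4 | h4⟩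
        · omega
        · rcases le_total (colLen P x.2) (colLen P d) with h | h
          · have := colLen_between hP hlt.le hcd.le le_rfl h
            omega
          · have := colLen_between hP hlt.le hcd.le h le_rfl
            omega
        · have := h4.2 d hd (by omega)
          omega
        · omega
        · exact hR h4.1
      · unfold colPrec at h3
        grind

open scoped Classical in
noncomputable def Rc (P : Finset Cell) (c : ℤ) : Finset Cell :=
  P.filter fun x => (x.1, c) ∈ P ∧ colLen P c ≤ colLen P x.2

theorem mem_Rc {P : Finset Cell} {c : ℤ} (x : Cell) :
    x ∈ Rc P c ↔ x ∈ P ∧ (x.1, c) ∈ P ∧ colLen P c ≤ colLen P x.2 := by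
  simp [Rc]

theorem Rc_congr {P : Finset Cell} (hP : IsMoon P) {c d : ℤ} (h : colLen P c = colLen P d) :
    Rc P c = Rc P d := by
  have h1 := (colLen_le_iff hP c d).1 h.le
  have h2 := (colLen_le_iff hP d c).1 h.ge
  ext x
  rw [mem_Rc, mem_Rc, h]
  grind

theorem exists_Icc (S : Finset ℤ) (hne : S.Nonempty)
    (h : ∀ a ∈ S, ∀ b ∈ S, ∀ x, a ≤ x → x ≤ b → x ∈ S) :
    ∃ a b : ℤ, a ≤ b ∧ S = Finset.Icc a b := by
  refine ⟨S.min' hne, S.max' hne, S.min'_le_max' hne, ?_⟩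
  ext x
  rw [Finset.mem_Icc]
  exact ⟨fun hx => ⟨S.min'_le x hx, S.le_max' x hx⟩,
    fun hx => h _ (S.min'_mem hne) _ (S.max'_mem hne) x hx.1 hx.2⟩

theorem isRect_prod (S T R : Finset _) (hS : S.Nonempty) (hT : T.Nonempty)
    (h : ∀ a ∈ S, ∀ b ∈ S, ∀ x, a ≤ x → x ≤ b → x ∈ S)
    (h' : ∀ a ∈ T, ∀ b ∈ T, ∀ x, a ≤ x → x ≤ b → x ∈ T)
    (hR : ∀ r c : ℤ, (r, c) ∈ R ↔ r ∈ S ∧ c ∈ T) : IsRect R := by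
  obtain ⟨a, b, hab, rfl⟩ := exists_Icc S hS h
  obtain ⟨a', b', hab', rfl⟩ := exists_Icc T hT h'
  refine ⟨a, b, a', b', hab, hab', ?_⟩
  ext ⟨r, x⟩
  rw [hR, Finset.mem_product]

theorem Rc_isRect {P : Finset Cell} (hP : IsMoon P) {c : ℤ} (hc : c ∈ colSet P) :
    IsRect (Rc P c) := by
  obtain ⟨r0, hr0⟩ := mem_colSet.1 hc
  apply isRect_prod ((P.filter fun x => x.2 = c).image Prod.fst)
    ((colSet P).filter fun x => colLen P c ≤ colLen P x)
  · exact ⟨r0, (mem_col P c r0).2 hr0⟩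
  · exact ⟨c, Finset.mem_filter.2 ⟨hc, le_rfl⟩⟩
  · intro a ha b hb x h1 h2
    rw [mem_col] at ha hb ⊢
    exact hP.2.1 c a b x ha hb h1 h2
  · intro a ha b hb x h1 h2
    rw [Finset.mem_filter] at ha hb ⊢
    have := colLen_between hP h1 h2 ha.2 hb.2
    exact ⟨mem_colSet.2 ⟨r0, (colLen_le_iff hP c x).1 this r0 hr0⟩, this⟩
  · intro r x
    rw [mem_Rc, mem_col, Finset.mem_filter]
    constructor
    · rintro ⟨h1, h2, h3⟩
      exact ⟨h2, mem_colSet.2 ⟨r, h1⟩, h3⟩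
    · rintro ⟨h1, h2, h3⟩
      exact ⟨(colLen_le_iff hP c x).1 h3 r h1, h1, h3⟩

theorem Rc_sub (P : Finset Cell) (c : ℤ) : Rc P c ⊆ P := fun x hx => ((mem_Rc x).1 hx).1

theorem mem_maxRects {P : Finset Cell} (hP : IsMoon P) (R : Finset Cell) :
    R ∈ maxRects P ↔ ∃ c ∈ colSet P, Rc P c = R := by
  classical
  unfold maxRects
  simp only [Finset.mem_filter, Finset.mem_powerset]
  unfold IsMaxRect
  constructor
  · rintro ⟨hRP, ⟨r₁, r₂, c₁, c₂, hr, hc, rfl⟩, -, hmax⟩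
    obtain ⟨c, hcm, hmin⟩ := Finset.exists_min_image (Finset.Icc c₁ c₂) (colLen P)
      ⟨c₁, by simp [hc]⟩
    have hcc : c ∈ colSet P := mem_colSet.2 ⟨r₁, hRP (by
      rw [Finset.mem_product]; exact ⟨by simp [hr], hcm⟩)⟩
    refine ⟨c, hcc, hmax _ (Rc_isRect hP hcc) (Rc_sub P c) ?_⟩
    rintro ⟨r, x⟩ hx
    rw [mem_Rc]
    refine ⟨hRP hx, ?_⟩
    rw [Finset.mem_product] at hx
    exact ⟨hRP (by rw [Finset.mem_product]; exact ⟨hx.1, hcm⟩), hmin _ hx.2⟩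
  · rintro ⟨c, hc, rfl⟩
    refine ⟨Rc_sub P c, Rc_isRect hP hc, Rc_sub P c, ?_⟩
    rintro R' ⟨r₁, r₂, c₁, c₂, hr, hcc, rfl⟩ hsub hle
    refine Finset.Subset.antisymm ?_ hle
    have key : ∀ s, (s, c) ∈ P → s ∈ Finset.Icc r₁ r₂ ∧ c ∈ Finset.Icc c₁ c₂ := by
      intro s hs
      have := hle ((mem_Rc (s, c)).2 ⟨hs, hs, le_rfl⟩)
      rwa [Finset.mem_product] at this
    obtain ⟨r0, hr0⟩ := mem_colSet.1 hc
    have h0 := (key r0 hr0).2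
    rintro ⟨r, x⟩ hx
    have hx' := hx
    rw [Finset.mem_product] at hx'
    refine (mem_Rc _).2 ⟨hsub hx, hsub (by rw [Finset.mem_product]; exact ⟨hx'.1, h0⟩), ?_⟩
    rw [colLen_le_iff hP]
    intro s hs
    exact hsub (by rw [Finset.mem_product]; exact ⟨(key s hs).1, hx'.2⟩)

theorem nRows_Rc (P : Finset Cell) (c : ℤ) :
    nRows (Rc P c) = colLen P c := by
  unfold nRows
  rw [colLen_eq]
  congr 1
  ext r
  rw [mem_col]
  simp only [Finset.mem_image]
  constructor
  · rintro ⟨x, hx, rfl⟩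
    exact ((mem_Rc x).1 hx).2.1
  · intro h
    exact ⟨(r, c), (mem_Rc _).2 ⟨h, h, le_rfl⟩, rfl⟩

theorem desR_mono {A B : Finset Cell} (hAB : A ⊆ B)
    (h : ∀ x ∈ A, ∀ y ∈ A, ∀ z ∈ B, x.1 ≤ z.1 → z.1 ≤ y.1 → z ∈ A) : desR A ≤ desR B := by
  unfold desR
  apply Finset.card_le_card
  intro p hp
  rw [Finset.mem_filter, Finset.mem_product] at *
  obtain ⟨⟨h1, h2⟩, h3, h4, h5⟩ := hp
  refine ⟨⟨hAB h1, hAB h2⟩, h3, h4, ?_⟩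
  intro z hz hzz
  exact h5 z (h _ h1 _ h2 z hz hzz.1.le hzz.2.le) hzz

theorem majR_mono {A B : Finset Cell} (hAB : A ⊆ B)
    (h : ∀ x ∈ A, ∀ y ∈ A, ∀ z ∈ B, x.1 ≤ z.1 → z.1 ≤ y.1 → z ∈ A) : majR A ≤ majR B := by
  unfold majR
  refine le_trans (Finset.sum_le_sum fun y hy => ?_)
    (Finset.sum_le_sum_of_subset hAB)
  apply desR_mono
  · exact Finset.filter_subset_filter _ hAB
  · intro a ha b hb z hz h1 h2
    rw [Finset.mem_filter] at *
    exact ⟨h a ha.1 b hb.1 z hz.1 h1 h2, hz.2⟩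

theorem zip_mem {α : Type*} (f : α → ℕ) : ∀ l : List α, l.Pairwise (fun a b => f a < f b) →
    ∀ p : α × α, p ∈ l.zip l.tail ↔
      p.1 ∈ l ∧ p.2 ∈ l ∧ f p.1 < f p.2 ∧ ∀ t ∈ l, ¬ (f p.1 < f t ∧ f t < f p.2)
  | [], _, p => by simp
  | [a], _, p => by simp; grind
  | a :: b :: t, h, p => by
    have ih := zip_mem f (b :: t) (List.Pairwise.of_cons h) p
    obtain ⟨x, y⟩ := p
    simp only [List.tail_cons, List.zip_cons_cons, List.mem_cons, List.pairwise_cons] at ih h ⊢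
    rw [ih]
    obtain ⟨h1, h2, h3⟩ := h
    constructor
    · rintro (h4 | h4)
      · cases h4
        grind
      · grind
    · rintro ⟨h4, h5, h6, h7⟩
      rcases h4 with rfl | h4
      · left
        grind
      · right
        grind

theorem zip_nodup {α β : Type*} : ∀ (l : List α) (m : List β), l.Nodup → (l.zip m).Nodup
  | [], _, _ => by simp
  | _ :: _, [], _ => by simp
  | a :: l, b :: m, h => by
    rw [List.nodup_cons] at h
    rw [List.zip_cons_cons, List.nodup_cons]
    exact ⟨fun hm => h.1 (List.of_mem_zip hm).1, zip_nodup l m h.2⟩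

/-- Sum over a list minus sum over consecutive pairs. -/
def FF {α : Type*} (g : α → ℤ) (h : α → α → ℤ) (l : List α) : ℤ :=
  (l.map g).sum - ((l.zip l.tail).map fun p => h p.1 p.2).sum

theorem FF_cons {α : Type*} (g : α → ℤ) (h : α → α → ℤ) (a b : α) (t : List α) :
    FF g h (a :: b :: t) = g a - h a b + FF g h (b :: t) := by
  simp [FF]; ring

theorem FF_one {α : Type*} (g : α → ℤ) (h : α → α → ℤ) (a : α) :
    FF g h [a] = g a := by
  simp [FF]

theorem exists_dedup {α : Type*} (f : α → ℕ) (g : α → ℤ) (h : α → α → ℤ)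
    (hg : ∀ a, h a a = g a) :
    ∀ (l : List α), l.Pairwise (fun a b => f a ≤ f b) →
      (∀ a ∈ l, ∀ b ∈ l, f a = f b → a = b) →
      ∃ m : List α, m.Pairwise (fun a b => f a < f b) ∧ (∀ x, x ∈ m ↔ x ∈ l) ∧
        m.head? = l.head? ∧ FF g h m = FF g h l
  | [], _, _ => ⟨[], by simp⟩
  | [a], _, _ => ⟨[a], by simp⟩
  | a :: b :: t, h1, h2 => by
    obtain ⟨m, m1, m2, m3, m4⟩ := exists_dedup f g h hg (b :: t) (List.Pairwise.of_cons h1)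
      (fun x hx y hy => h2 x (List.mem_cons_of_mem _ hx) y (List.mem_cons_of_mem _ hy))
    by_cases hab : f a = f b
    · have := h2 a (by simp) b (by simp) hab
      subst this
      refine ⟨m, m1, ?_, ?_, ?_⟩
      · intro x; rw [m2]; simp
      · rw [m3]; simp
      · rw [m4, FF_cons, hg]; ring
    · obtain ⟨m', rfl⟩ : ∃ m', m = b :: m' := by
        cases m with
        | nil => simp at m3
        | cons x m' => simp at m3; exact ⟨m', by rw [m3]⟩
      refine ⟨a :: b :: m', ?_, ?_, ?_, ?_⟩
      · rw [List.pairwise_cons]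
        refine ⟨?_, m1⟩
        intro x hx
        rw [List.pairwise_cons, List.pairwise_cons] at h1
        rw [m2] at hx
        have h3 := h1.1 b (by simp)
        rcases List.mem_cons.1 hx with rfl | hx
        · omega
        · have := h1.2.1 x hx
          omega
      · intro x
        rw [List.mem_cons, m2, List.mem_cons (l := b :: t)]
      · simp
      · rw [FF_cons, FF_cons, m4]

theorem FF_nonneg {α : Type*} (g : α → ℤ) (h : α → α → ℤ) (f : α → ℕ) :
    ∀ (l : List α), l.Pairwise (fun a b => f a < f b) →
    (∀ a ∈ l, 0 ≤ g a) → (∀ a ∈ l, ∀ b ∈ l, f a < f b → h a b ≤ g b) →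
    0 ≤ FF g h l ∧ ∀ a ∈ l.head?, g a ≤ FF g h l
  | [], _, _, _ => by simp [FF]
  | [a], _, h1, _ => by simpa [FF] using h1
  | a :: b :: t, h1, h2, h3 => by
    have ih := (FF_nonneg g h f (b :: t) (List.Pairwise.of_cons h1)
      (fun x hx => h2 x (List.mem_cons_of_mem _ hx))
      (fun x hx y hy => h3 x (List.mem_cons_of_mem _ hx) y (List.mem_cons_of_mem _ hy))).2 b
        (by simp)
    rw [FF_cons]
    have h4 := h3 a (by simp) b (by simp) ((List.pairwise_cons.1 h1).1 b (by simp))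
    have h5 := h2 a (by simp)
    refine ⟨by linarith, ?_⟩
    intro x hx
    simp at hx
    subst hx
    linarith

theorem Mrect_eq_Rc {P : Finset Cell} (hP : IsMoon P) {c : ℤ}
    (h : ∀ x ∈ colSet P, colLen P c ≤ colLen P x → x = c ∨ colPrec P c x) :
    Mrect P c = Rc P c := by
  ext x
  rw [mem_Mrect hP, mem_Rc]
  constructor
  · rintro ⟨h1, h2, h3 | h3⟩
    · exact ⟨h1, h2, by rw [h3]⟩
    · exact ⟨h1, h2, colPrec_len h3⟩
  · rintro ⟨h1, h2, h3⟩
    exact ⟨h1, h2, h _ (mem_colSet.2 ⟨x.1, h1⟩) h3⟩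

theorem FF_switch {P : Finset Cell} (hP : IsMoon P) (M : Finset Cell) :
    ∀ (c : ℤ) (t : List ℤ), (c :: t).Pairwise (colPrec P) →
    (∀ x ∈ colSet P, x ∈ c :: t ∨ colPrec P x c) →
    FF (fun c => (majR (M ∩ Mrect P c) : ℤ))
        (fun c d => (majR (M ∩ Mrect P c ∩ Mrect P d) : ℤ)) (c :: t)
      - (majR (M ∩ Mrect P c) : ℤ)
    = FF (fun c => (majR (M ∩ Rc P c) : ℤ))
        (fun c d => (majR (M ∩ Rc P c ∩ Rc P d) : ℤ)) (c :: t)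
      - (majR (M ∩ Rc P c) : ℤ)
  | c, [], _, _ => by simp [FF]
  | c, d :: t, h1, h2 => by
    rw [FF_cons, FF_cons]
    obtain ⟨h3, h4⟩ := List.pairwise_cons.1 h1
    have hcd := h3 d (by simp)
    have ih := FF_switch hP M d t h4 (by
      intro x hx
      rcases h2 x hx with h | h
      · rcases List.mem_cons.1 h with rfl | h
        · exact Or.inr hcd
        · exact Or.inl h
      · exact Or.inr (colPrec_trans h hcd))
    have key : (majR (M ∩ Mrect P d) : ℤ) - majR (M ∩ Mrect P c ∩ Mrect P d)
        = (majR (M ∩ Rc P d) : ℤ) - majR (M ∩ Rc P c ∩ Rc P d) := by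
      rcases (colPrec_len hcd).eq_or_lt with he | hlt
      · have e1 : M ∩ Mrect P c ∩ Mrect P d = M ∩ Mrect P d := by
          have hs : Mrect P d ⊆ Mrect P c := by
            intro x hx
            rw [mem_Mrect hP] at *
            refine ⟨hx.1, (colLen_le_iff hP d c).1 he.ge _ hx.2.1, Or.inr ?_⟩
            rcases hx.2.2 with h | h
            · rw [h]; exact hcd
            · exact colPrec_trans hcd h
          rw [Finset.inter_assoc, Finset.inter_eq_right.2 hs]
        have e2 : M ∩ Rc P c ∩ Rc P d = M ∩ Rc P d := by
          rw [Rc_congr hP he, Finset.inter_assoc, Finset.inter_self]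
        rw [e1, e2]; ring
      · have e1 : Mrect P d = Rc P d := by
          apply Mrect_eq_Rc hP
          intro x hx hl
          rcases h2 x hx with h | h
          · rcases List.mem_cons.1 h with rfl | h
            · omega
            · rcases List.mem_cons.1 h with rfl | h
              · exact Or.inl rfl
              · exact Or.inr ((List.pairwise_cons.1 h4).1 x h)
          · have := colPrec_len h
            omega
        have e2 : Mrect P c ∩ Rc P d = Rc P c ∩ Rc P d := by
          ext x
          rw [Finset.mem_inter, Finset.mem_inter, mem_Mrect hP, mem_Rc, mem_Rc]
          constructor
          · rintro ⟨⟨a1, a2, a3⟩, a4, a5, a6⟩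
            exact ⟨⟨a1, a2, by omega⟩, a4, a5, a6⟩
          · rintro ⟨⟨a1, a2, a3⟩, a4, a5, a6⟩
            exact ⟨⟨a1, a2, Or.inr (Or.inl (by omega))⟩, a4, a5, a6⟩
        rw [e1, Finset.inter_assoc, e2, Finset.inter_assoc]
    linarith

theorem majP_eq {P : Finset Cell} (M : Finset Cell) (m : List (Finset Cell))
    (hm : m.Pairwise (fun a b => nRows a < nRows b)) (hmem : ∀ R, R ∈ m ↔ R ∈ maxRects P)
    (hnn : ∀ a ∈ m, ∀ b ∈ m, nRows a < nRows b → majR (M ∩ a ∩ b) ≤ majR (M ∩ b)) :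
    (majP P M : ℤ) = FF (fun R => (majR (M ∩ R) : ℤ))
      (fun R S => (majR (M ∩ R ∩ S) : ℤ)) m := by
  classical
  have hnn' := (FF_nonneg (fun R => (majR (M ∩ R) : ℤ))
      (fun R S => (majR (M ∩ R ∩ S) : ℤ)) nRows m hm (by intros; positivity)
      (by intro a ha b hb h; exact_mod_cast hnn a ha b hb h)).1
  have hnd : m.Nodup := hm.imp (by rintro a b h rfl; omega)
  have s1 : ∑ R ∈ maxRects P, majR (M ∩ R) = (m.map fun R => majR (M ∩ R)).sum := by
    rw [← List.sum_toFinset _ hnd]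
    apply Finset.sum_congr _ (fun _ _ => rfl)
    ext R
    rw [List.mem_toFinset, hmem]
  have s2 : ∑ p ∈ (maxRects P ×ˢ maxRects P).filter
        (fun p => nRows p.1 < nRows p.2 ∧
          ∀ T ∈ maxRects P, ¬ (nRows p.1 < nRows T ∧ nRows T < nRows p.2)),
      majR (M ∩ p.1 ∩ p.2) = ((m.zip m.tail).map fun p => majR (M ∩ p.1 ∩ p.2)).sum := by
    rw [← List.sum_toFinset _ (zip_nodup m m.tail hnd)]
    apply Finset.sum_congr _ (fun _ _ => rfl)
    ext p
    rw [List.mem_toFinset, zip_mem nRows m hm, Finset.mem_filter, Finset.mem_product]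
    simp only [hmem]
    tauto
  have s3 : FF (fun R => (majR (M ∩ R) : ℤ)) (fun R S => (majR (M ∩ R ∩ S) : ℤ)) m
      = ((m.map fun R => majR (M ∩ R)).sum : ℕ)
        - (((m.zip m.tail).map fun p => majR (M ∩ p.1 ∩ p.2)).sum : ℕ) := by
    unfold FF
    rw [Nat.cast_list_sum, Nat.cast_list_sum, List.map_map, List.map_map]
    rfl
  rw [s3] at hnn' ⊢
  rw [← s1, ← s2]
  unfold majP
  rw [Nat.cast_sub]
  · rw [s1, s2]; exact_mod_cast sub_nonneg.1 hnn'

theorem FF_map {α β : Type*} (r : α → β) (g : β → ℤ) (h : β → β → ℤ) (l : List α) :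
    FF g h (l.map r) = FF (fun a => g (r a)) (fun a b => h (r a) (r b)) l := by
  unfold FF
  rw [← List.map_tail, List.zip_map, List.map_map, List.map_map]
  rfl

end Helpers

/-- **Theorem (STATEMENT 4).** Definitions 2.2 and 2.2' of the major index agree: for any
filling `M` of a moon polyomino `P` and the list `l` of its columns sorted by the total
order `≺`, `maj(M) = Σ_j maj(M_j) − Σ_j maj(M_j ∩ M_{j+1})`, where `M_j` is the restriction
of `M` to the rectangle `𝓜(c_{i_j})` and `maj(M)` is computed via the maximal rectangles. -/
theorem maj_two_definitions_agree (P : Finset Cell) (hP : IsMoon P)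
    (M : Finset Cell) (hM : IsFilling P M)
    (l : List ℤ) (hnd : l.Nodup) (hmem : ∀ c : ℤ, c ∈ l ↔ c ∈ colSet P)
    (hsorted : l.Chain' (colPrec P)) :
    (majP P M : ℤ)
      = (l.map fun c => (majR (M ∩ Mrect P c) : ℤ)).sum
        - ((l.zip l.tail).map fun p => (majR (M ∩ Mrect P p.1 ∩ Mrect P p.2) : ℤ)).sum := by
  have hpw : l.Pairwise (colPrec P) := by
    haveI : IsTrans ℤ (colPrec P) := ⟨fun _ _ _ => colPrec_trans⟩
    exact List.isChain_iff_pairwise.1 hsorted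
  obtain ⟨m, m1, m2, -, m4⟩ := exists_dedup nRows (fun R => (majR (M ∩ R) : ℤ))
    (fun R S => (majR (M ∩ R ∩ S) : ℤ))
    (by intro a; simp only [Finset.inter_assoc, Finset.inter_self]) (l.map (Rc P))
    (by
      rw [List.pairwise_map]
      refine hpw.imp ?_
      intro a b h
      rw [nRows_Rc, nRows_Rc]
      exact colPrec_len h)
    (by
      intro a ha b hb h
      obtain ⟨c, -, rfl⟩ := List.mem_map.1 ha
      obtain ⟨d, -, rfl⟩ := List.mem_map.1 hb
      rw [nRows_Rc, nRows_Rc] at h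
      exact Rc_congr hP h)
  have hmm : ∀ R, R ∈ m ↔ ∃ c ∈ colSet P, Rc P c = R := by
    intro R
    rw [m2, List.mem_map]
    simp only [hmem]
  rw [majP_eq M m m1 (fun R => by rw [hmm, mem_maxRects hP]), m4, FF_map]
  · change _ = FF (fun c => (majR (M ∩ Mrect P c) : ℤ))
        (fun c d => (majR (M ∩ Mrect P c ∩ Mrect P d) : ℤ)) l
    cases l with
    | nil => simp [FF]
    | cons c t =>
      have h1 := FF_switch hP M c t hpw (fun x hx => Or.inl ((hmem x).2 hx))
      have h2 : Mrect P c = Rc P c := by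
        apply Mrect_eq_Rc hP
        intro x hx _
        rcases List.mem_cons.1 ((hmem x).2 hx) with h | h
        · exact Or.inl h
        · exact Or.inr ((List.pairwise_cons.1 hpw).1 x h)
      rw [h2] at h1
      linarith
  · intro a ha b hb hlt
    obtain ⟨c, -, rfl⟩ := (hmm a).1 ha
    obtain ⟨d, -, rfl⟩ := (hmm b).1 hb
    rw [nRows_Rc, nRows_Rc] at hlt
    apply majR_mono
    · intro x hx
      simp only [Finset.mem_inter] at *
      tauto
    · intro x hx y hy z hz h1 h2
      simp only [Finset.mem_inter, mem_Rc] at *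
      refine ⟨⟨hz.1, hz.2.1, hP.2.1 c x.1 y.1 z.1 hx.1.2.2.1 hy.1.2.2.1 h1 h2, by omega⟩, hz.2⟩

end MoonPolyomino
end

section
/- Let M be a 01-filling of a top-aligned stack polyomino 𝓜 with nonempty rows r_1,…,r_n numbered from top to bottom, and for each i let M(r_i) denote the restriction of M to the largest rectangle contained in 𝓜 whose bottom row is r_i. Then maj(M) = Σ_{i=1}^{n} des(M(r_i)). -/
open Polynomial

namespace MoonPolyomino

/-- The largest rectangle contained in the top-aligned stack polyomino `P` whose bottom
row is row `r`. -/
def topRect (P : Finset Cell) (r : ℤ) : Finset Cell :=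
  P.filter fun x => x.1 ≤ r ∧ (r, x.2) ∈ P

section aux
open scoped Classical

noncomputable def brk (P : Finset Cell) : Finset ℤ :=
  (rowSet P).filter fun b => ∃ c, (b, c) ∈ P ∧ (b + 1, c) ∉ P

lemma mem_brk (P : Finset Cell) (b : ℤ) :
    b ∈ brk P ↔ ∃ c, (b, c) ∈ P ∧ (b + 1, c) ∉ P := by
  simp only [brk, Finset.mem_filter, rowSet, Finset.mem_image]
  constructor
  · exact fun h => h.2
  · rintro ⟨c, h1, h2⟩
    exact ⟨⟨(b, c), h1, rfl⟩, c, h1, h2⟩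

lemma mem_topRect (P : Finset Cell) (r : ℤ) (x : Cell) :
    x ∈ topRect P r ↔ x ∈ P ∧ x.1 ≤ r ∧ (r, x.2) ∈ P := by
  simp [topRect]

lemma no_brk (P : Finset Cell) (r b : ℤ) (h : r ≤ b)
    (hn : ∀ a ∈ brk P, a < b → a < r) (c : ℤ) (hc : (r, c) ∈ P) : (b, c) ∈ P := by
  have key : ∀ s, r ≤ s → s ≤ b → (s, c) ∈ P := by
    intro s hs
    induction s, hs using Int.le_induction with
    | base => intro _; exact hc
    | succ s hs ih =>
      intro h'
      by_contra hcon
      have : s ∈ brk P := (mem_brk P s).2 ⟨c, ih (by omega), hcon⟩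
      have := hn s this (by omega)
      omega
  exact key b h le_rfl

lemma exists_brk (P : Finset Cell) (y : Cell) (hy : y ∈ P) : ∃ b ∈ brk P, y.1 ≤ b := by
  have hne : (P.filter fun x => x.2 = y.2).Nonempty := ⟨y, by simp [hy]⟩
  obtain ⟨z, hz, hmax⟩ := Finset.exists_max_image _ (fun x : Cell => x.1) hne
  simp only [Finset.mem_filter] at hz hmax
  refine ⟨z.1, (mem_brk P _).2 ⟨z.2, hz.1, fun h => ?_⟩, hmax y ⟨hy, rfl⟩⟩
  have := hmax _ ⟨h, hz.2⟩
  simp at this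

lemma topRect_isRect (P : Finset Cell) (hP : IsMoon P) (r₀ : ℤ)
    (hT : ∀ x ∈ P, r₀ ≤ x.1 ∧ (r₀, x.2) ∈ P) (b c : ℤ) (hc : (b, c) ∈ P) :
    ∃ c₁ c₂ : ℤ, c₁ ≤ c₂ ∧ topRect P b = Finset.Icc r₀ b ×ˢ Finset.Icc c₁ c₂ := by
  have hne : (P.filter fun x => x.1 = b).Nonempty := ⟨(b, c), by simp [hc]⟩
  obtain ⟨u, hu, hmax⟩ := Finset.exists_max_image _ (fun x : Cell => x.2) hne
  obtain ⟨v, hv, hmin⟩ := Finset.exists_min_image _ (fun x : Cell => x.2) hne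
  simp only [Finset.mem_filter] at hu hv hmax hmin
  obtain ⟨u1, u2⟩ := u
  obtain ⟨v1, v2⟩ := v
  obtain ⟨hu, rfl⟩ := hu
  obtain ⟨hv, rfl⟩ := hv
  refine ⟨v2, u2, hmin _ ⟨hu, rfl⟩, ?_⟩
  ext ⟨x1, x2⟩
  simp only [mem_topRect, Finset.mem_product, Finset.mem_Icc]
  constructor
  · rintro ⟨h1, h2, h3⟩
    exact ⟨⟨(hT _ h1).1, h2⟩, hmin _ ⟨h3, rfl⟩, hmax _ ⟨h3, rfl⟩⟩
  · rintro ⟨⟨h1, h2⟩, h3, h4⟩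
    have h5 := hP.1 _ _ _ _ hv hu h3 h4
    exact ⟨hP.2.1 _ _ _ _ (hT _ h5).2 h5 h1 h2, h2, h5⟩

lemma rect_sub (P : Finset Cell) (r₁ r₂ c₁ c₂ : ℤ) (hr : r₁ ≤ r₂)
    (h : Finset.Icc r₁ r₂ ×ˢ Finset.Icc c₁ c₂ ⊆ P) :
    Finset.Icc r₁ r₂ ×ˢ Finset.Icc c₁ c₂ ⊆ topRect P r₂ := by
  rintro ⟨x1, x2⟩ hx
  rw [mem_topRect]
  refine ⟨h hx, ?_⟩
  simp only [Finset.mem_product, Finset.mem_Icc] at hx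
  refine ⟨hx.1.2, h ?_⟩
  simp only [Finset.mem_product, Finset.mem_Icc]
  exact ⟨⟨hr, le_rfl⟩, hx.2⟩

lemma maxRects_eq (P : Finset Cell) (hP : IsMoon P) (r₀ : ℤ)
    (hT : ∀ x ∈ P, r₀ ≤ x.1 ∧ (r₀, x.2) ∈ P) :
    maxRects P = (brk P).image (topRect P) := by
  have hsub : ∀ b, topRect P b ⊆ P := fun b => Finset.filter_subset _ _
  have hrect : ∀ b c, (b, c) ∈ P → IsRect (topRect P b) := by
    intro b c hc
    obtain ⟨c₁, c₂, h, e⟩ := topRect_isRect P hP r₀ hT b c hc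
    exact ⟨r₀, b, c₁, c₂, (hT _ hc).1, h, e⟩
  ext R
  simp only [maxRects, Finset.mem_filter, Finset.mem_powerset, Finset.mem_image]
  constructor
  · rintro ⟨hRP, ⟨r₁, r₂, c₁, c₂, hr, hc, rfl⟩, -, hmax⟩
    have hs := rect_sub P r₁ r₂ c₁ c₂ hr hRP
    have hcell : (r₂, c₁) ∈ P := hRP (by simp [hr, hc])
    have e := hmax _ (hrect _ _ hcell) (hsub _) hs
    refine ⟨r₂, ?_, e⟩
    by_contra hcon
    rw [mem_brk] at hcon
    push Not at hcon
    have hs2 : topRect P r₂ ⊆ topRect P (r₂ + 1) := by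
      intro x hx
      rw [mem_topRect] at hx ⊢
      exact ⟨hx.1, by omega, hcon _ hx.2.2⟩
    have e2 := hmax _ (hrect _ _ (hcon _ hcell)) (hsub _) (hs.trans hs2)
    have hm : (r₂ + 1, c₁) ∈ topRect P (r₂ + 1) := by
      rw [mem_topRect]
      exact ⟨hcon _ hcell, le_rfl, hcon _ hcell⟩
    rw [e2] at hm
    simp at hm
  · rintro ⟨b, hb, rfl⟩
    obtain ⟨c, hc, hc'⟩ := (mem_brk P b).1 hb
    refine ⟨hsub b, hrect _ _ hc, hsub b, ?_⟩
    rintro R' ⟨r₁, r₂, c₁, c₂, hr, hcc, rfl⟩ hRP hle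
    have hm : (b, c) ∈ topRect P b := by
      rw [mem_topRect]
      exact ⟨hc, le_rfl, hc⟩
    have hm2 := hle hm
    simp only [Finset.mem_product, Finset.mem_Icc] at hm2
    have : r₂ = b := by
      by_contra hne
      apply hc'
      apply hRP
      simp only [Finset.mem_product, Finset.mem_Icc]
      omega
    subst this
    exact (rect_sub P r₁ r₂ c₁ c₂ hr hRP).antisymm hle

lemma nRows_top (P : Finset Cell) (hP : IsMoon P) (r₀ : ℤ)
    (hT : ∀ x ∈ P, r₀ ≤ x.1 ∧ (r₀, x.2) ∈ P) (b : ℤ) (hb : b ∈ brk P) :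
    r₀ ≤ b ∧ (nRows (topRect P b) : ℤ) = b + 1 - r₀ := by
  obtain ⟨c, hc, -⟩ := (mem_brk P b).1 hb
  obtain ⟨c₁, c₂, h, e⟩ := topRect_isRect P hP r₀ hT b c hc
  have h0 := (hT _ hc).1
  refine ⟨h0, ?_⟩
  simp only at h0
  have : (topRect P b).image Prod.fst = Finset.Icc r₀ b := by
    rw [e]
    exact Finset.product_image_fst (Finset.nonempty_Icc.2 h)
  rw [nRows, this, Int.card_Icc]
  omega

lemma filt_eq (P : Finset Cell) (hP : IsMoon P) (M : Finset Cell)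
    (y : Cell) (b : ℤ) (hyb : y.1 ≤ b) (hn : ∀ a ∈ brk P, a < b → a < y.1) :
    ((M ∩ topRect P b).filter fun x => x.1 ≤ y.1) = M ∩ topRect P y.1 := by
  ext x
  simp only [Finset.mem_filter, Finset.mem_inter, mem_topRect]
  constructor
  · rintro ⟨⟨h1, h2, h3, h4⟩, h5⟩
    exact ⟨h1, h2, h5, hP.2.1 _ _ _ _ h2 h4 h5 hyb⟩
  · rintro ⟨h1, h2, h3, h4⟩
    exact ⟨⟨h1, h2, by omega, no_brk P _ _ hyb hn _ h4⟩, h3⟩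

lemma key_b (P : Finset Cell) (hP : IsMoon P) (M : Finset Cell) (hM : M ⊆ P)
    (b : ℤ) :
    majR (M ∩ topRect P b) =
      (∑ a ∈ (brk P).filter (fun a => a < b ∧ ∀ t ∈ brk P, ¬ (a < t ∧ t < b)),
        majR (M ∩ topRect P a ∩ topRect P b)) +
      ∑ y ∈ M.filter (fun y => y.1 ≤ b ∧ ∀ a ∈ brk P, a < b → a < y.1),
        desR (M ∩ topRect P y.1) := by
  have hN : ∑ y ∈ M.filter (fun y => y.1 ≤ b ∧ ∀ a ∈ brk P, a < b → a < y.1),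
        desR (M ∩ topRect P y.1) =
      ∑ y ∈ (M ∩ topRect P b).filter (fun y => ∀ a ∈ brk P, a < b → a < y.1),
        desR ((M ∩ topRect P b).filter fun x => x.1 ≤ y.1) := by
    apply Finset.sum_congr
    · ext y
      simp only [Finset.mem_filter, Finset.mem_inter, mem_topRect]
      constructor
      · rintro ⟨h1, h2, h3⟩
        exact ⟨⟨h1, hM h1, h2, no_brk P _ _ h2 h3 _ (hM h1)⟩, h3⟩
      · rintro ⟨⟨h1, h2, h3, h4⟩, h5⟩
        exact ⟨h1, h3, h5⟩
    · intro y hy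
      simp only [Finset.mem_filter, Finset.mem_inter, mem_topRect] at hy
      rw [filt_eq P hP M y b hy.1.2.2.1 hy.2]
  rw [hN, majR, ← Finset.sum_filter_not_add_sum_filter (M ∩ topRect P b)
    (fun y => ∀ a ∈ brk P, a < b → a < y.1)]
  congr 1
  by_cases hne : ((brk P).filter (fun a => a < b)).Nonempty
  · obtain ⟨a, ha, hmax⟩ := Finset.exists_max_image _ (fun x : ℤ => x) hne
    simp only [Finset.mem_filter] at ha hmax
    have hs : (brk P).filter (fun a => a < b ∧ ∀ t ∈ brk P, ¬ (a < t ∧ t < b)) = {a} := by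
      ext t
      simp only [Finset.mem_filter, Finset.mem_singleton]
      constructor
      · rintro ⟨h1, h2, h3⟩
        have := hmax t ⟨h1, h2⟩
        have := h3 a ha.1
        omega
      · rintro rfl
        refine ⟨ha.1, ha.2, fun s hs h => ?_⟩
        have := hmax s ⟨hs, h.2⟩
        omega
    rw [hs, Finset.sum_singleton, majR]
    apply Finset.sum_congr
    · ext y
      simp only [Finset.mem_filter, Finset.mem_inter, mem_topRect]
      constructor
      · rintro ⟨⟨h1, h2, h3, h4⟩, h5⟩
        push Not at h5
        obtain ⟨t, ht, htb, hty⟩ := h5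
        have := hmax t ⟨ht, htb⟩
        have hya : y.1 ≤ a := by omega
        exact ⟨⟨h1, h2, hya, hP.2.1 _ _ _ _ h2 h4 hya ha.2.le⟩, h2, h3, h4⟩
      · rintro ⟨⟨h1, h2, h3, h4⟩, -, h6, h7⟩
        refine ⟨⟨h1, h2, h6, h7⟩, fun h => ?_⟩
        have := h a ha.1 ha.2
        omega
    · intro y hy
      congr 1
      simp only [Finset.mem_filter, Finset.mem_inter, mem_topRect] at hy
      have hya : y.1 ≤ a := hy.1.2.2.1
      ext x
      simp only [Finset.mem_filter, Finset.mem_inter, mem_topRect]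
      constructor
      · rintro ⟨⟨h1, h2, h3, h4⟩, h5⟩
        have hxa : x.1 ≤ a := by omega
        exact ⟨⟨⟨h1, h2, hxa, hP.2.1 _ _ _ _ h2 h4 hxa ha.2.le⟩, h2, h3, h4⟩, h5⟩
      · rintro ⟨⟨⟨h1, -⟩, h3⟩, h4⟩
        exact ⟨⟨h1, h3⟩, h4⟩
  · rw [Finset.not_nonempty_iff_eq_empty, Finset.filter_eq_empty_iff] at hne
    rw [Finset.filter_eq_empty_iff.2 (fun a ha h => hne ha h.1),
      Finset.filter_eq_empty_iff.2 (fun y _ h => h (fun a ha hab => absurd hab (hne ha)))]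
    simp

lemma sum_N (P M : Finset Cell) (hM : M ⊆ P) (D : Cell → ℕ) :
    ∑ b ∈ brk P, ∑ y ∈ M.filter (fun y => y.1 ≤ b ∧ ∀ a ∈ brk P, a < b → a < y.1), D y
      = ∑ y ∈ M, D y := by
  rw [Finset.sum_comm' (t' := M)
    (s' := fun y => (brk P).filter (fun b => y.1 ≤ b ∧ ∀ a ∈ brk P, a < b → a < y.1))
    (by intro x y; simp only [Finset.mem_filter]; tauto)]
  apply Finset.sum_congr rfl
  intro y hy
  obtain ⟨b₀, hb₀, hyb₀⟩ := exists_brk P y (hM hy)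
  have hne : ((brk P).filter (fun b => y.1 ≤ b)).Nonempty := ⟨b₀, by simp [hb₀, hyb₀]⟩
  obtain ⟨b, hb, hmin⟩ := Finset.exists_min_image _ (fun x : ℤ => x) hne
  simp only [Finset.mem_filter] at hb hmin
  have : (brk P).filter (fun b => y.1 ≤ b ∧ ∀ a ∈ brk P, a < b → a < y.1) = {b} := by
    ext t
    simp only [Finset.mem_filter, Finset.mem_singleton]
    constructor
    · rintro ⟨h1, h2, h3⟩
      have := hmin t ⟨h1, h2⟩
      have := h3 b hb.1
      omega
    · rintro rfl
      refine ⟨hb.1, hb.2, fun s hs h => ?_⟩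
      by_contra hcon
      have := hmin s ⟨hs, by omega⟩
      omega
  rw [this, Finset.sum_singleton]

lemma pairs_sum (P : Finset Cell) (hP : IsMoon P) (r₀ : ℤ)
    (hT : ∀ x ∈ P, r₀ ≤ x.1 ∧ (r₀, x.2) ∈ P) (M : Finset Cell) :
    ∑ p ∈ (maxRects P ×ˢ maxRects P).filter
        (fun p => nRows p.1 < nRows p.2 ∧
          ∀ T ∈ maxRects P, ¬ (nRows p.1 < nRows T ∧ nRows T < nRows p.2)),
      majR (M ∩ p.1 ∩ p.2) =
    ∑ b ∈ brk P, ∑ a ∈ (brk P).filter (fun a => a < b ∧ ∀ t ∈ brk P, ¬ (a < t ∧ t < b)),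
        majR (M ∩ topRect P a ∩ topRect P b) := by
  have hn := nRows_top P hP r₀ hT
  have hlt : ∀ a ∈ brk P, ∀ b ∈ brk P,
      (nRows (topRect P a) < nRows (topRect P b) ↔ a < b) := by
    intro a ha b hb
    have := hn a ha
    have := hn b hb
    omega
  rw [Finset.sum_sigma']
  symm
  apply Finset.sum_bij (fun (s : (_ : ℤ) × ℤ) _ => (topRect P s.2, topRect P s.1))
  · rintro ⟨b, a⟩ h
    simp only [Finset.mem_sigma, Finset.mem_filter] at h
    obtain ⟨hb, ha, hab, hno⟩ := h
    simp only [maxRects_eq P hP r₀ hT, Finset.mem_filter, Finset.mem_product]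
    refine ⟨⟨Finset.mem_image_of_mem _ ha, Finset.mem_image_of_mem _ hb⟩,
      (hlt a ha b hb).2 hab, fun T hTm => ?_⟩
    obtain ⟨t, ht, rfl⟩ := Finset.mem_image.1 hTm
    rw [hlt a ha t ht, hlt t ht b hb]
    exact hno t ht
  · rintro ⟨b, a⟩ h ⟨b', a'⟩ h' e
    simp only [Finset.mem_sigma, Finset.mem_filter] at h h'
    simp only [Prod.mk.injEq] at e
    have h1 := hn a h.2.1
    have h2 := hn b h.1
    have h3 := hn a' h'.2.1
    have h4 := hn b' h'.1
    rw [e.1] at h1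
    rw [e.2] at h2
    have e1 : a = a' := by omega
    have e2 : b = b' := by omega
    subst e1 e2
    rfl
  · rintro ⟨R, R'⟩ h
    simp only [maxRects_eq P hP r₀ hT, Finset.mem_filter, Finset.mem_product] at h
    obtain ⟨⟨hR, hR'⟩, h1, h2⟩ := h
    obtain ⟨a, ha, rfl⟩ := Finset.mem_image.1 hR
    obtain ⟨b, hb, rfl⟩ := Finset.mem_image.1 hR'
    refine ⟨⟨b, a⟩, ?_, rfl⟩
    simp only [Finset.mem_sigma, Finset.mem_filter]
    refine ⟨hb, ha, (hlt a ha b hb).1 h1, fun t ht => ?_⟩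
    have := h2 _ (Finset.mem_image_of_mem _ ht)
    rwa [hlt a ha t ht, hlt t ht b hb] at this
  · rintro ⟨b, a⟩ h
    rfl

end aux

/-- **Theorem (STATEMENT 5, Proposition 3.1).** For a filling `M` of a top-aligned stack
polyomino `P`, `maj(M) = Σᵢ des(M(rᵢ))`, the sum over the nonempty rows `rᵢ` (i.e. over the
1-cells `y ∈ M`) of the descent statistic of the restriction of `M` to the largest
rectangle of `P` with bottom row `rᵢ`. -/
theorem maj_top_aligned_stack (P : Finset Cell) (hP : IsMoon P) (hT : TopAligned P)
    (M : Finset Cell) (hM : IsFilling P M) :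
    majP P M = ∑ y ∈ M, desR (M ∩ topRect P y.1) := by
  obtain ⟨r₀, hT⟩ := hT
  have hinj : Set.InjOn (topRect P) (brk P) := by
    intro a ha b hb e
    have h1 := nRows_top P hP r₀ hT a ha
    have h2 := nRows_top P hP r₀ hT b hb
    rw [e] at h1
    omega
  rw [majP, pairs_sum P hP r₀ hT M, maxRects_eq P hP r₀ hT, Finset.sum_image hinj,
    Finset.sum_congr rfl (fun b _ => key_b P hP M hM.1 b), Finset.sum_add_distrib,
    sum_N P M hM.1 (fun y => desR (M ∩ topRect P y.1))]
  omega

end MoonPolyomino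
end

section
/- Let n be a positive integer, let w = w_1⋯w_k be a word with w_i < n for all i, let m ≥ 0, and let S(w) be the set of all words obtained by inserting m copies of the letter n into w. Then the multiset {maj(w') − maj(w) : w' ∈ S(w)} equals the multiset {i_1 + i_2 + ⋯ + i_m : 0 ≤ i_1 ≤ i_2 ≤ ⋯ ≤ i_m ≤ k}. The same statement holds if instead w_i > 1 for all i and S(w) is the set of all words obtained by inserting m copies of the letter 1 into w. -/
open Polynomial

namespace MoonPolyomino

/-- Major index of a reversed word. -/
def rmaj : List ℕ → ℕ
  | [] => 0
  | [_] => 0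
  | x :: y :: l => rmaj (y :: l) + if x < y then l.length + 1 else 0

/-- Insertions of `m` copies of `a` in a (reversed) word. -/
def insG (a : ℕ) : List ℕ → ℕ → Multiset (List ℕ)
  | [], m => {List.replicate m a}
  | x :: u, 0 => {x :: u}
  | x :: u, m + 1 => (insG a (x :: u) m).map (a :: ·) + (insG a u (m + 1)).map (x :: ·)

/-- Sums of the partitions in a box. -/
def boxT : ℕ → ℕ → Multiset ℕ
  | 0, _ => {0}
  | _ + 1, 0 => {0}
  | m + 1, k + 1 => boxT (m + 1) k + (boxT m (k + 1)).map (· + (k + 1))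

theorem boxT_zero_right (m : ℕ) : boxT m 0 = {0} := by cases m <;> simp [boxT]
theorem boxT_zero_left (k : ℕ) : boxT 0 k = {0} := by simp [boxT]

theorem boxT_rec1 (m k : ℕ) : boxT (m + 1) (k + 1)
    = boxT (m + 1) k + (boxT m (k + 1)).map (· + (k + 1)) := by rw [boxT]

theorem map_add_add (s : Multiset ℕ) (c d : ℕ) :
    (s.map (· + c)).map (· + d) = s.map (· + (c + d)) := by
  simp [Multiset.map_map, Function.comp_def, add_assoc]

theorem boxT_rec2 (m k : ℕ) : boxT (m + 1) (k + 1)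
    = boxT m (k + 1) + (boxT (m + 1) k).map (· + (m + 1)) := by
  induction m generalizing k with
  | zero =>
    induction k with
    | zero => simp [boxT]
    | succ k ih =>
      conv_lhs => rw [boxT_rec1, ih]
      conv_rhs => rw [boxT_rec1 0 k]
      simp only [boxT_zero_left, Multiset.map_add, map_add_add, Multiset.map_singleton]
      rw [show 0 + (k + 1 + 1) = 0 + (k + 1 + (0 + 1)) by omega]
      abel
  | succ m ihm =>
    induction k with
    | zero =>
      conv_lhs => rw [boxT_rec1, ihm 0]
      conv_rhs => rw [boxT_rec1 m 0]
      simp only [boxT_zero_right, Multiset.map_add, map_add_add, Multiset.map_singleton]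
      rw [show 0 + (m + 1 + (0 + 1)) = 0 + (m + 1 + 1) by omega]
      abel
    | succ k ih =>
      conv_lhs => rw [boxT_rec1, ih, ihm (k + 1)]
      conv_rhs => rw [boxT_rec1 m (k + 1), boxT_rec1 (m + 1) k]
      simp only [Multiset.map_add, map_add_add]
      rw [show k + 1 + (m + 1 + 1) = m + 1 + (k + 1 + 1) by omega]
      abel

theorem mem_monoTuples (m k : ℕ) (f : Fin m → ℕ) :
    f ∈ monoTuples m k ↔ (∀ i, f i ≤ k) ∧ Monotone f := by
  simp [monoTuples, Fintype.mem_piFinset, Nat.lt_succ_iff]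

theorem mono_snoc {m : ℕ} (g : Fin m → ℕ) (c : ℕ) (hg : Monotone g) (hc : ∀ i, g i ≤ c) :
    Monotone (Fin.snoc (α := fun _ => ℕ) g c : Fin (m + 1) → ℕ) := by
  intro i j hij
  induction j using Fin.lastCases with
  | last =>
    induction i using Fin.lastCases with
    | last => simp
    | cast i => simpa using hc i
  | cast j =>
    induction i using Fin.lastCases with
    | last => exact absurd hij (by simp [Fin.lt_def])
    | cast i => simpa using hg (by simpa using hij)

theorem monoTuples_rec (m k : ℕ) : (monoTuples (m + 1) (k + 1)).val
    = (monoTuples (m + 1) k).val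
      + (monoTuples m (k + 1)).val.map
        (fun g => (Fin.snoc (α := fun _ => ℕ) g (k + 1) : Fin (m + 1) → ℕ)) := by
  have hinj : Function.Injective
      (fun g : Fin m → ℕ => (Fin.snoc (α := fun _ => ℕ) g (k + 1) : Fin (m + 1) → ℕ)) := by
    intro g g' h
    funext i
    have := congrFun h i.castSucc
    simpa using this
  refine (Multiset.Nodup.ext (Finset.nodup _) ?_).2 ?_
  · rw [Multiset.nodup_add]
    refine ⟨Finset.nodup _, (Finset.nodup _).map hinj, ?_⟩
    rw [Multiset.disjoint_left]
    intro f hf hf2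
    rw [Finset.mem_val, mem_monoTuples] at hf
    rw [Multiset.mem_map] at hf2
    obtain ⟨g, -, rfl⟩ := hf2
    have := hf.1 (Fin.last m)
    simp at this
  · intro f
    rw [Multiset.mem_add, Multiset.mem_map, Finset.mem_val, Finset.mem_val, mem_monoTuples,
      mem_monoTuples]
    constructor
    · rintro ⟨h1, h2⟩
      by_cases hl : f (Fin.last m) = k + 1
      · right
        refine ⟨Fin.init f, ?_, ?_⟩
        · rw [Finset.mem_val, mem_monoTuples]
          refine ⟨fun i => h1 _, fun i j hij => h2 (by simpa using hij)⟩
        · rw [← hl]; exact Fin.snoc_init_self f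
      · left
        refine ⟨fun i => ?_, h2⟩
        have := h2 (Fin.le_last i)
        have := h1 (Fin.last m)
        omega
    · rintro (⟨h1, h2⟩ | ⟨g, hg, rfl⟩)
      · exact ⟨fun i => (h1 i).trans (by omega), h2⟩
      · rw [Finset.mem_val, mem_monoTuples] at hg
        refine ⟨fun i => ?_, mono_snoc g _ hg.2 hg.1⟩
        induction i using Fin.lastCases with
        | last => simp
        | cast i => simpa using hg.1 i

theorem monoTuples_boxT (m k : ℕ) :
    (monoTuples m k).val.map (fun f => ∑ i, f i) = boxT m k := by
  induction m generalizing k with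
  | zero =>
    have : monoTuples 0 k = {fun i => i.elim0} := by
      ext f
      rw [mem_monoTuples, Finset.mem_singleton]
      refine ⟨fun _ => Subsingleton.elim _ _, fun _ => ⟨fun i => i.elim0, fun i => i.elim0⟩⟩
    rw [this]; simp [boxT]
  | succ m ihm =>
    induction k with
    | zero =>
      have : monoTuples (m + 1) 0 = {fun _ => 0} := by
        ext f
        rw [mem_monoTuples, Finset.mem_singleton]
        constructor
        · rintro ⟨h, -⟩; funext i; simpa using h i
        · rintro rfl; exact ⟨fun _ => le_rfl, monotone_const⟩
      rw [this]; simp [boxT]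
    | succ k ih =>
      rw [monoTuples_rec, Multiset.map_add, ih, boxT_rec1, ← ihm (k + 1)]
      simp [Multiset.map_map, Function.comp_def, Fin.sum_univ_castSucc]

theorem insG_mem (a : ℕ) (r : List ℕ) (ha : a ∉ r) (m : ℕ) (l : List ℕ) :
    l ∈ insG a r m ↔ l.count a = m ∧ l.filter (fun x => decide (x ≠ a)) = r := by
  induction l generalizing r m with
  | nil =>
    cases r with
    | nil =>
      simp only [insG, Multiset.mem_singleton]
      cases m <;> simp [List.replicate_succ]
    | cons x u => cases m <;> simp [insG]
  | cons b l ih =>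
    cases r with
    | nil =>
      simp only [insG, Multiset.mem_singleton]
      rw [List.eq_replicate_iff]
      constructor
      · rintro ⟨h1, h2⟩
        refine ⟨?_, ?_⟩
        · rw [← h1]; exact List.count_eq_length.2 (fun b hb => (h2 b hb).symm)
        · rw [List.filter_eq_nil_iff]; intro c hc; simp [h2 c hc]
      · rintro ⟨h1, h2⟩
        rw [List.filter_eq_nil_iff] at h2
        have h3 : ∀ c ∈ b :: l, c = a := by intro c hc; simpa using h2 c hc
        refine ⟨?_, h3⟩
        rw [← h1]; exact (List.count_eq_length.2 (fun b hb => (h3 b hb).symm)).symm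
    | cons x u =>
      have hx : x ≠ a := by rintro rfl; simp at ha
      have hu : a ∉ u := fun h => ha (List.mem_cons_of_mem _ h)
      have key : ∀ l' : List ℕ, l' = u → l'.filter (fun x => decide (x ≠ a)) = u := by
        rintro l' rfl
        rw [List.filter_eq_self]; intro c hc
        have : c ≠ a := by rintro rfl; exact hu hc
        simp [this]
      cases m with
      | zero =>
        simp only [insG, Multiset.mem_singleton]
        by_cases hb : b = a
        · subst hb; simp; intro h; exact absurd h.symm hx
        · simp only [List.count_cons, List.filter_cons, hb]
          simp only [ne_eq, beq_iff_eq, hb, if_false, add_zero, not_false_iff, decide_true, if_true,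
            List.cons.injEq]
          constructor
          · rintro ⟨h1, rfl⟩
            exact ⟨List.count_eq_zero.2 hu, h1, key l rfl⟩
          · rintro ⟨h0, h1, h2⟩
            refine ⟨h1, ?_⟩
            rw [← h2, eq_comm, List.filter_eq_self]
            intro c hc
            have : c ≠ a := by rintro rfl; exact List.count_eq_zero.1 h0 hc
            simp [this]
      | succ m =>
        simp only [insG, Multiset.mem_add, Multiset.mem_map, List.cons.injEq]
        by_cases hb : b = a
        · subst hb
          have := ih (x :: u) ha m
          simp [hx] at this ⊢
          exact this
        · have := ih u hu (m + 1)
          have hb' : a ≠ b := fun h => hb h.symm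
          simp only [List.count_cons, List.filter_cons]
          simp [hb, hb'] at this ⊢
          rw [this]
          constructor
          · rintro ⟨⟨h1, h2⟩, h3⟩; exact ⟨h1, h3.symm, h2⟩
          · rintro ⟨h1, h3, h2⟩; exact ⟨⟨h1, h2⟩, h3.symm⟩

theorem insG_nodup (a : ℕ) (r : List ℕ) (ha : a ∉ r) (m : ℕ) : (insG a r m).Nodup := by
  induction r generalizing m with
  | nil => simp [insG]
  | cons x u ih =>
    have hx : x ≠ a := by rintro rfl; simp at ha
    have hu : a ∉ u := fun h => ha (List.mem_cons_of_mem _ h)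
    induction m with
    | zero => simp [insG]
    | succ m ihm =>
      rw [insG, Multiset.nodup_add]
      refine ⟨ihm.map (List.cons_injective), (ih hu _).map (List.cons_injective), ?_⟩
      rw [Multiset.disjoint_left]
      intro l h1 h2
      simp only [Multiset.mem_map] at h1 h2
      obtain ⟨l1, -, rfl⟩ := h1
      obtain ⟨l2, -, h⟩ := h2
      exact hx (List.cons.inj h).1

theorem insG_length (a : ℕ) (r : List ℕ) (m : ℕ) :
    ∀ l ∈ insG a r m, l.length = r.length + m := by
  induction r generalizing m with
  | nil => simp [insG]
  | cons x u ih =>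
    induction m with
    | zero => simp [insG]
    | succ m ihm =>
      intro l hl
      simp only [insG, Multiset.mem_add, Multiset.mem_map] at hl
      rcases hl with ⟨v, hv, rfl⟩ | ⟨v, hv, rfl⟩
      · have := ihm v hv; simp at this ⊢; omega
      · have := ih _ v hv; simp at this ⊢; omega

theorem insG_zero (a : ℕ) (r : List ℕ) : insG a r 0 = {r} := by cases r <;> simp [insG]

theorem insG_letters (a : ℕ) (r : List ℕ) (m : ℕ) :
    ∀ l ∈ insG a r m, ∀ z ∈ l, z = a ∨ z ∈ r := by
  induction r generalizing m with
  | nil => simp [insG]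
  | cons x u ih =>
    induction m with
    | zero =>
      intro l hl z hz
      rw [insG_zero, Multiset.mem_singleton] at hl
      exact Or.inr (hl ▸ hz)
    | succ m ihm =>
      intro l hl z hz
      simp only [insG, Multiset.mem_add, Multiset.mem_map] at hl
      rcases hl with ⟨v, hv, rfl⟩ | ⟨v, hv, rfl⟩
      · rcases List.mem_cons.1 hz with h | h
        · exact Or.inl h
        · exact ihm v hv z h
      · rcases List.mem_cons.1 hz with h | h
        · right; simp [h]
        · rcases ih _ v hv z h with h | h
          · exact Or.inl h
          · right; simp [h]

theorem rmaj_cons_of_le (a : ℕ) (l : List ℕ) (h : ∀ z ∈ l, z ≤ a) : rmaj (a :: l) = rmaj l := by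
  cases l with
  | nil => simp [rmaj]
  | cons y l =>
    have := h y (by simp)
    simp [rmaj]; omega

theorem rmaj_replicate (a m : ℕ) : rmaj (List.replicate m a) = 0 := by
  induction m with
  | zero => simp [rmaj]
  | succ m ih =>
    rw [List.replicate_succ, rmaj_cons_of_le, ih]
    intro z hz; exact (List.eq_of_mem_replicate hz).le

theorem map_shift (s : Multiset (List ℕ)) (f g : List ℕ → ℕ) (c : ℕ)
    (h : ∀ v ∈ s, f v = g v + c) : s.map f = (s.map g).map (· + c) := by
  rw [Multiset.map_map]; exact Multiset.map_congr rfl h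

theorem case_big (a : ℕ) (r : List ℕ) (hr : ∀ x ∈ r, x < a) :
    (∀ m, (insG a r m).map rmaj = (boxT m r.length).map (· + rmaj r)) ∧
    (∀ x, x < a → ∀ m, (insG a r m).map (fun v => rmaj (x :: v))
      = (boxT m r.length).map (· + (rmaj (x :: r) + m))) := by
  induction r with
  | nil =>
    refine ⟨fun m => ?_, fun x hx m => ?_⟩
    · simp [insG, boxT_zero_right, rmaj_replicate, rmaj]
    · cases m with
      | zero => simp [insG, boxT, rmaj]
      | succ m =>
        have := rmaj_replicate a (m + 1)
        rw [List.replicate_succ] at this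
        simp [insG, boxT, rmaj, List.replicate_succ, this, hx]
  | cons y u ih =>
    have hy : y < a := hr y (by simp)
    obtain ⟨ihG, ihB⟩ := ih (fun x hx => hr x (by simp [hx]))
    have hG : ∀ m, (insG a (y :: u) m).map rmaj
        = (boxT m (y :: u).length).map (· + rmaj (y :: u)) := by
      intro m
      induction m with
      | zero => simp [insG_zero, boxT]
      | succ m ihm =>
        rw [insG, Multiset.map_add, Multiset.map_map, Multiset.map_map]
        have h1 : (insG a (y :: u) m).map (rmaj ∘ (a :: ·)) = (insG a (y :: u) m).map rmaj := by
          refine Multiset.map_congr rfl fun v hv => ?_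
          refine rmaj_cons_of_le a v fun z hz => ?_
          rcases insG_letters a _ m v hv z hz with h | h
          · exact h.le
          · exact (hr z h).le
        have h2 := ihB y hy (m + 1)
        rw [h1, ihm]
        simp only [Function.comp_def]
        rw [h2, List.length_cons, boxT_rec2, Multiset.map_add, map_add_add]
        rw [show rmaj (y :: u) + (m + 1) = m + 1 + rmaj (y :: u) by omega]
    refine ⟨hG, fun x hx m => ?_⟩
    cases m with
    | zero => simp [insG_zero, boxT]
    | succ m =>
      rw [insG, Multiset.map_add, Multiset.map_map, Multiset.map_map]
      have h1 : (insG a (y :: u) m).map ((fun v => rmaj (x :: v)) ∘ (a :: ·))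
          = ((insG a (y :: u) m).map rmaj).map (· + (u.length + 1 + m + 1)) := by
        refine map_shift _ _ _ _ fun v hv => ?_
        have hl := insG_length a _ m v hv
        have : rmaj (a :: v) = rmaj v := by
          refine rmaj_cons_of_le a v fun z hz => ?_
          rcases insG_letters a _ m v hv z hz with h | h
          · exact h.le
          · exact (hr z h).le
        simp at hl
        simp [rmaj, this, hx, hl]
      have h2 : (insG a u (m + 1)).map ((fun v => rmaj (x :: v)) ∘ (y :: ·))
          = ((insG a u (m + 1)).map (fun v => rmaj (y :: v))).map
            (· + (if x < y then u.length + m + 2 else 0)) := by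
        refine map_shift _ _ _ _ fun v hv => ?_
        have hl := insG_length a _ (m + 1) v hv
        simp only [Function.comp_apply, rmaj, hl]
        rfl
      rw [h1, h2, hG, ihB y hy, List.length_cons]
      simp only [map_add_add, rmaj]
      split_ifs with hxy
      · rw [boxT_rec2, Multiset.map_add, map_add_add]
        congr 3 <;> (funext t; omega)
      · rw [boxT_rec1, Multiset.map_add, map_add_add, add_comm]
        congr 3 <;> (funext t; omega)

theorem case_small (a : ℕ) (r : List ℕ) (hr : ∀ x ∈ r, a < x) :
    (∀ m, (insG a r m).map rmaj = (boxT m r.length).map (· + rmaj r)) ∧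
    (∀ m, (insG a r m).map (fun v => rmaj (a :: v))
      = (boxT m r.length).map (· + (r.length + rmaj r))) ∧
    (∀ x, a < x → ∀ m, (insG a r m).map (fun v => rmaj (x :: v))
      = (boxT m r.length).map (· + rmaj (x :: r))) := by
  induction r with
  | nil =>
    refine ⟨fun m => ?_, fun m => ?_, fun x hx m => ?_⟩
    · simp [insG, boxT_zero_right, rmaj_replicate, rmaj]
    · have := rmaj_replicate a (m + 1)
      rw [List.replicate_succ] at this
      simp [insG, boxT_zero_right, this, rmaj]
    · have : rmaj (x :: List.replicate m a) = 0 := by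
        rw [rmaj_cons_of_le, rmaj_replicate]
        intro z hz; rw [List.eq_of_mem_replicate hz]; exact hx.le
      simp [insG, boxT_zero_right, rmaj, this]
  | cons y u ih =>
    have hy : a < y := hr y (by simp)
    obtain ⟨ihG, ihA, ihB⟩ := ih (fun x hx => hr x (by simp [hx]))
    have hA : ∀ m, (insG a (y :: u) m).map (fun v => rmaj (a :: v))
        = (boxT m (y :: u).length).map (· + ((y :: u).length + rmaj (y :: u))) := by
      intro m
      induction m with
      | zero => simp [insG_zero, boxT, rmaj, hy]; omega
      | succ m ihm =>
        rw [insG, Multiset.map_add, Multiset.map_map, Multiset.map_map]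
        have h1 : (insG a (y :: u) m).map ((fun v => rmaj (a :: v)) ∘ (a :: ·))
            = (insG a (y :: u) m).map (fun v => rmaj (a :: v)) := by
          refine Multiset.map_congr rfl fun v hv => ?_
          simp [rmaj]
        have h2 : (insG a u (m + 1)).map ((fun v => rmaj (a :: v)) ∘ (y :: ·))
            = ((insG a u (m + 1)).map (fun v => rmaj (y :: v))).map
              (· + (u.length + m + 2)) := by
          refine map_shift _ _ _ _ fun v hv => ?_
          have hl := insG_length a _ (m + 1) v hv
          simp only [Function.comp_apply, rmaj, hl, hy, if_true]
          rfl
        rw [h1, ihm, h2, ihB y hy, List.length_cons, boxT_rec2, Multiset.map_add]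
        simp only [map_add_add]
        congr 3; funext t; omega
    have hG : ∀ m, (insG a (y :: u) m).map rmaj
        = (boxT m (y :: u).length).map (· + rmaj (y :: u)) := by
      intro m
      cases m with
      | zero => simp [insG_zero, boxT]
      | succ m =>
        rw [insG, Multiset.map_add, Multiset.map_map, Multiset.map_map]
        have h2 := ihB y hy (m + 1)
        have h1 := hA m
        simp only [Function.comp_def]
        rw [h1, h2, List.length_cons, boxT_rec1, Multiset.map_add, map_add_add, add_comm]
    refine ⟨hG, hA, fun x hx m => ?_⟩
    cases m with
    | zero => simp [insG_zero, boxT]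
    | succ m =>
      rw [insG, Multiset.map_add, Multiset.map_map, Multiset.map_map]
      have h1 : (insG a (y :: u) m).map ((fun v => rmaj (x :: v)) ∘ (a :: ·))
          = (insG a (y :: u) m).map (fun v => rmaj (a :: v)) := by
        refine Multiset.map_congr rfl fun v hv => ?_
        simp [rmaj, hx.le]
      have h2 : (insG a u (m + 1)).map ((fun v => rmaj (x :: v)) ∘ (y :: ·))
          = ((insG a u (m + 1)).map (fun v => rmaj (y :: v))).map
            (· + (if x < y then u.length + m + 2 else 0)) := by
        refine map_shift _ _ _ _ fun v hv => ?_
        have hl := insG_length a _ (m + 1) v hv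
        simp only [Function.comp_apply, rmaj, hl]
        rfl
      rw [h1, h2, hA, ihB y hy, List.length_cons]
      simp only [map_add_add, rmaj]
      split_ifs with hxy
      · rw [boxT_rec2, Multiset.map_add, map_add_add]
        congr 3 <;> (funext t; omega)
      · rw [boxT_rec1, Multiset.map_add, map_add_add, add_comm]
        congr 3

theorem majW_snoc (v : List ℕ) (y x : ℕ) :
    majW (v ++ [y] ++ [x]) = majW (v ++ [y]) + if x < y then v.length + 1 else 0 := by
  unfold majW
  have e1 : (v ++ [y] ++ [x]).length - 1 = v.length + 1 := by simp
  have e2 : (v ++ [y]).length - 1 = v.length := by simp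
  rw [e1, e2, Finset.sum_range_succ]
  congr 1
  · refine Finset.sum_congr rfl fun i hi => ?_
    rw [Finset.mem_range] at hi
    rw [List.getD_append (v ++ [y]) [x] 0 (i + 1) (by simp; omega),
      List.getD_append (v ++ [y]) [x] 0 i (by simp; omega)]
  · have h1 : (v ++ [y] ++ [x]).getD (v.length + 1) 0 = x := by
      rw [List.getD_append_right _ _ _ _ (by simp)]; simp
    have h2 : (v ++ [y] ++ [x]).getD v.length 0 = y := by
      rw [List.getD_append _ _ _ _ (by simp), List.getD_append_right _ _ _ _ (by simp)]; simp
    rw [h1, h2]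

theorem majW_reverse (r : List ℕ) : majW r.reverse = rmaj r := by
  induction r with
  | nil => simp [majW, rmaj]
  | cons x r ih =>
    cases r with
    | nil => simp [majW, rmaj]
    | cons y l =>
      rw [rmaj, ← ih, List.reverse_cons, List.reverse_cons, majW_snoc]
      simp

theorem finish (w : List ℕ) (a m : ℕ) (ha : a ∉ w)
    (h : (insG a w.reverse m).map rmaj = (boxT m w.reverse.length).map (· + rmaj w.reverse))
    (S : Finset (List ℕ)) (hS : ∀ l : List ℕ, l ∈ S ↔ IsInsertion w a m l) :
    S.val.map (fun w' => (majW w' : ℤ) - (majW w : ℤ))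
      = (monoTuples m w.length).val.map (fun f => ((∑ i, f i : ℕ) : ℤ)) := by
  have ha' : a ∉ w.reverse := by simpa using ha
  have e : S.val = (insG a w.reverse m).map List.reverse := by
    refine (Multiset.Nodup.ext S.nodup
      ((insG_nodup a _ ha' m).map List.reverse_injective)).2 fun l => ?_
    rw [Finset.mem_val, hS, Multiset.mem_map]
    constructor
    · rintro ⟨-, h2, h3⟩
      refine ⟨l.reverse, (insG_mem a _ ha' m _).2 ⟨by simpa using h2, ?_⟩, by simp⟩
      rw [List.filter_reverse, h3]
    · rintro ⟨v, hv, rfl⟩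
      have hl := insG_length a _ m v hv
      obtain ⟨h2, h3⟩ := (insG_mem a _ ha' m _).1 hv
      refine ⟨by simpa using hl, by simpa using h2, ?_⟩
      rw [List.filter_reverse, h3, List.reverse_reverse]
  have hw : majW w = rmaj w.reverse := by rw [← majW_reverse, List.reverse_reverse]
  have h' := congrArg (Multiset.map (fun t : ℕ => (t : ℤ) - (majW w : ℤ))) h
  rw [← monoTuples_boxT, List.length_reverse] at h'
  simp only [Multiset.map_map, Function.comp_def, ← hw] at h'
  rw [e, Multiset.map_map]
  simp only [Function.comp_def, majW_reverse]
  rw [h']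
  refine Multiset.map_congr rfl fun f _ => ?_
  push_cast; ring

/-- **Theorem (STATEMENT 6, Lemma 4.6).** Let `w` be a word of positive integers with all
letters `< n` and let `S(w)` be the set of words obtained by inserting `m` copies of `n`
into `w`.  Then the multiset `{maj(w') − maj(w) : w' ∈ S(w)}` equals the multiset
`{i₁ + ⋯ + i_m : 0 ≤ i₁ ≤ ⋯ ≤ i_m ≤ k}`, where `k` is the length of `w`.  The same holds
if instead all letters of `w` are `> 1` and copies of the letter `1` are inserted. -/
theorem insertion_maj_multiset (n : ℕ) (hn : 0 < n) (w : List ℕ)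
    (hpos : ∀ x ∈ w, 0 < x) (m : ℕ) :
    ((∀ x ∈ w, x < n) →
      ∀ S : Finset (List ℕ), (∀ l : List ℕ, l ∈ S ↔ IsInsertion w n m l) →
        S.val.map (fun w' => (majW w' : ℤ) - (majW w : ℤ))
          = (monoTuples m w.length).val.map (fun f => ((∑ i, f i : ℕ) : ℤ))) ∧
    ((∀ x ∈ w, 1 < x) →
      ∀ S : Finset (List ℕ), (∀ l : List ℕ, l ∈ S ↔ IsInsertion w 1 m l) →
        S.val.map (fun w' => (majW w' : ℤ) - (majW w : ℤ))
          = (monoTuples m w.length).val.map (fun f => ((∑ i, f i : ℕ) : ℤ))) := by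
  refine ⟨fun h S hS => ?_, fun h S hS => ?_⟩
  · exact finish w n m (fun hm => lt_irrefl _ (h n hm))
      ((case_big n w.reverse (by simpa using h)).1 m) S hS
  · exact finish w 1 m (fun hm => lt_irrefl _ (h 1 hm))
      ((case_small 1 w.reverse (by simpa using h)).1 m) S hS

end MoonPolyomino
end

section
/- Let n be a positive integer, let w = w_1⋯w_k be a word with w_i < n for all i, let m ≥ 0, and let S(w) be the set of all words obtained by inserting m copies of the letter n into w. Then Σ_{w'∈S(w)} q^{maj(w')} = q^{maj(w)} · [k+m choose m]_q as polynomials in q. The same identity holds if instead w_i > 1 for all i and S(w) is the set of all words obtained by inserting m copies of the letter 1 into w. -/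
open Polynomial

namespace MoonPolyomino

/-- recursive Gaussian coefficient `[k+m choose m]` -/
noncomputable def gRec : ℕ → ℕ → Polynomial ℤ
  | 0, _ => 1
  | _ + 1, 0 => 1
  | k + 1, m + 1 => gRec (k + 1) m + X ^ (m + 1) * gRec k (m + 1)

lemma gRec_zero_left (m : ℕ) : gRec 0 m = 1 := by simp [gRec]
lemma gRec_zero_right (k : ℕ) : gRec k 0 = 1 := by cases k <;> simp [gRec]
lemma gRec_p1 (k m : ℕ) :
    gRec (k + 1) (m + 1) = gRec (k + 1) m + X ^ (m + 1) * gRec k (m + 1) := by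
  rw [gRec]

lemma gRec_p2 : ∀ k m : ℕ,
    gRec (k + 1) (m + 1) = X ^ (k + 1) * gRec (k + 1) m + gRec k (m + 1)
  | 0, 0 => by
    rw [gRec_p1]; simp [gRec_zero_left, gRec_zero_right]; ring
  | 0, m + 1 => by
    have h := gRec_p2 0 m
    have h1 := gRec_p1 0 m
    have h2 := gRec_p1 0 (m + 1)
    simp only [gRec_zero_left, zero_add] at *
    rw [h2]
    linear_combination h - X * h1
  | k + 1, 0 => by
    have h := gRec_p2 k 0
    have h1 := gRec_p1 k 0
    have h2 := gRec_p1 (k + 1) 0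
    simp only [gRec_zero_right, zero_add] at *
    rw [h2]
    linear_combination X * h - h1
  | k + 1, m + 1 => by
    have a := gRec_p2 (k + 1) m
    have b := gRec_p2 k (m + 1)
    have c := gRec_p1 (k + 1) m
    have d := gRec_p1 k (m + 1)
    rw [gRec_p1 (k + 1) (m + 1)]
    linear_combination a + X ^ (m + 2) * b - X ^ (k + 2) * c - d

lemma gauss_zero_right (h : ℤ) : gaussBinom h 0 = 1 := by
  classical
  unfold gaussBinom
  rw [Finset.sum_eq_single (fun i => i.elim0)]
  · simp
  · intro b _ hb
    exact absurd (Subsingleton.elim _ _) hb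
  · intro hh
    exfalso; apply hh
    simp [Monotone]
    exact Subsingleton.elim _ _

lemma gauss_zero_left (m : ℕ) : gaussBinom ((0 + m : ℕ) : ℤ) m = 1 := by
  classical
  unfold gaussBinom
  rw [Finset.sum_eq_single (fun _ => 0)]
  · simp
  · intro b hb hb'
    exfalso; apply hb'
    simp only [Finset.mem_filter, Fintype.mem_piFinset, Finset.mem_Icc] at hb
    funext i
    have := hb.1 i
    push_cast at this
    omega
  · intro hh
    exfalso; apply hh
    simp [Monotone]

lemma gauss_p1 (k m : ℕ) :
    gaussBinom ((k + 1 + (m + 1) : ℕ) : ℤ) (m + 1) =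
      gaussBinom ((k + 1 + m : ℕ) : ℤ) m
        + X ^ (m + 1) * gaussBinom ((k + (m + 1) : ℕ) : ℤ) (m + 1) := by
  classical
  unfold gaussBinom
  rw [← Finset.sum_filter_add_sum_filter_not _ (fun f : Fin (m + 1) → ℤ => f 0 = 0)]
  congr 1
  · refine Finset.sum_nbij' (fun f => Fin.tail f) (fun f => (Fin.cons 0 f : Fin (m + 1) → ℤ))
      ?_ ?_ ?_ ?_ ?_
    · intro f hf
      simp only [Finset.mem_filter, Fintype.mem_piFinset, Finset.mem_Icc] at hf ⊢
      obtain ⟨⟨h1, h2⟩, h3⟩ := hf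
      refine ⟨fun i => ?_, fun i j hij => h2 (Fin.succ_le_succ_iff.2 hij)⟩
      have := h1 i.succ
      simp only [Fin.tail]
      push_cast at this ⊢
      constructor <;> linarith
    · intro f hf
      simp only [Finset.mem_filter, Fintype.mem_piFinset, Finset.mem_Icc] at hf ⊢
      obtain ⟨h1, h2⟩ := hf
      refine ⟨⟨fun i => ?_, ?_⟩, by simp⟩
      · refine Fin.cases ?_ (fun j => ?_) i
        · simp; omega
        · have := h1 j
          simp only [Fin.cons_succ]
          push_cast at this ⊢
          constructor <;> linarith
      · intro i j
        refine Fin.cases ?_ (fun i => ?_) i <;> refine Fin.cases ?_ (fun j => ?_) j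
        · simp
        · intro _; simpa using (h1 j).1
        · intro hh; simp at hh
        · intro hh; simpa using h2 (Fin.succ_le_succ_iff.1 hh)
    · intro f hf
      simp only [Finset.mem_filter] at hf
      rw [← hf.2]; exact Fin.cons_self_tail f
    · intro f hf
      simp
    · intro f hf
      simp only [Finset.mem_filter] at hf
      rw [Fin.sum_univ_succ, hf.2]
      simp [Fin.tail]
  · rw [Finset.mul_sum]
    refine Finset.sum_nbij' (fun f i => f i - 1) (fun f i => f i + 1) ?_ ?_ ?_ ?_ ?_
    · intro f hf
      simp only [Finset.mem_filter, Fintype.mem_piFinset, Finset.mem_Icc] at hf ⊢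
      obtain ⟨⟨h1, h2⟩, h3⟩ := hf
      refine ⟨fun i => ?_, fun i j hij => by have := h2 hij; simp only; linarith⟩
      have a := h1 i
      have b := h1 0
      have c := h2 (Fin.zero_le i)
      push_cast at a b ⊢
      omega
    · intro f hf
      simp only [Finset.mem_filter, Fintype.mem_piFinset, Finset.mem_Icc] at hf ⊢
      obtain ⟨h1, h2⟩ := hf
      refine ⟨⟨fun i => ?_, fun i j hij => by have := h2 hij; simp only; linarith⟩, ?_⟩
      · have a := h1 i
        push_cast at a ⊢
        omega
      · have a := h1 0
        omega
    · intro f hf; simp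
    · intro f hf; simp
    · intro f hf
      simp only [Finset.mem_filter, Fintype.mem_piFinset, Finset.mem_Icc] at hf
      obtain ⟨⟨h1, h2⟩, h3⟩ := hf
      rw [← pow_add]
      congr 1
      have : ∀ i, 0 ≤ f i - 1 := by
        intro i
        have b := h1 0
        have c := h2 (Fin.zero_le i)
        omega
      have h0 := Finset.sum_nonneg (s := Finset.univ) (fun i _ => this i)
      have e : ∑ i, (f i - 1) = ∑ i, f i - ((m + 1 : ℕ) : ℤ) := by
        rw [Finset.sum_sub_distrib]; simp
      rw [e] at h0 ⊢
      omega

lemma gauss_eq : ∀ k m : ℕ, gaussBinom ((k + m : ℕ) : ℤ) m = gRec k m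
  | 0, m => by rw [gauss_zero_left, gRec_zero_left]
  | k + 1, 0 => by rw [gauss_zero_right, gRec_zero_right]
  | k + 1, m + 1 => by
    rw [gauss_p1, gRec_p1, gauss_eq (k + 1) m, gauss_eq k (m + 1)]

/-- maj of the reversed word -/
def mR : List ℕ → ℕ
  | [] => 0
  | [_] => 0
  | x :: y :: t => (if x < y then t.length + 1 else 0) + mR (y :: t)

lemma majW_concat (v : List ℕ) (y x : ℕ) :
    majW (v ++ [y] ++ [x]) = (if x < y then v.length + 1 else 0) + majW (v ++ [y]) := by
  unfold majW
  have h1 : (v ++ [y] ++ [x]).length - 1 = v.length + 1 := by simp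
  have h2 : (v ++ [y]).length - 1 = v.length := by simp
  rw [h1, h2, Finset.sum_range_succ, add_comm]
  congr 1
  · simp [List.getD_eq_getElem?_getD]
  · apply Finset.sum_congr rfl
    intro i hi
    rw [Finset.mem_range] at hi
    rw [List.getD_append _ _ _ (i + 1) (by simp; omega), List.getD_append _ _ _ i (by simp; omega)]

lemma majW_reverse_s7 : ∀ l : List ℕ, majW l.reverse = mR l
  | [] => by simp [majW, mR]
  | [_] => by simp [majW, mR]
  | x :: y :: t => by
    have := majW_reverse_s7 (y :: t)
    rw [mR, ← this, List.reverse_cons, List.reverse_cons, majW_concat]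
    simp

/-- reversed insertions -/
def ins (a : ℕ) : List ℕ → ℕ → Finset (List ℕ)
  | [], 0 => {[]}
  | [], m + 1 => (ins a [] m).image (a :: ·)
  | x :: v, 0 => (ins a v 0).image (x :: ·)
  | x :: v, m + 1 => (ins a (x :: v) m).image (a :: ·) ∪ (ins a v (m + 1)).image (x :: ·)

lemma mem_ins (a : ℕ) : ∀ (w : List ℕ) (m : ℕ), a ∉ w → ∀ l : List ℕ,
    l ∈ ins a w m ↔ l.count a = m ∧ l.filter (fun x => decide (x ≠ a)) = w
  | [], 0, _, l => by
    rw [ins]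
    cases l <;> simp [List.filter_cons]
    grind
  | [], m + 1, h, l => by
    have ih := mem_ins a [] m h
    rw [ins]
    simp only [Finset.mem_image, ih]
    cases l with
    | nil => simp
    | cons y t =>
      by_cases hy : y = a
      · subst hy; simp
      · simp [hy, Ne.symm hy]
  | x :: v, 0, h, l => by
    have ih := mem_ins a v 0 (fun hh => h (List.mem_cons_of_mem _ hh))
    rw [ins]
    simp only [Finset.mem_image, ih]
    cases l with
    | nil => simp
    | cons y t =>
      by_cases hy : y = a
      · subst hy; simp at h; simp; grind
      · simp [hy, Ne.symm hy]; grind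
  | x :: v, m + 1, h, l => by
    have ih := mem_ins a v (m + 1) (fun hh => h (List.mem_cons_of_mem _ hh))
    have ih2 := mem_ins a (x :: v) m h
    rw [ins]
    simp only [Finset.mem_union, Finset.mem_image, ih, ih2]
    cases l with
    | nil => simp
    | cons y t =>
      by_cases hy : y = a
      · subst hy; simp at h; simp; grind
      · simp [hy, Ne.symm hy]; grind

lemma len_ins (a : ℕ) : ∀ (w : List ℕ) (m : ℕ), ∀ l ∈ ins a w m, l.length = w.length + m
  | [], 0, l => by rw [ins]; simp
  | [], m + 1, l => by
    have ih := len_ins a [] m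
    rw [ins]; simp only [Finset.mem_image]
    rintro ⟨t, ht, rfl⟩
    simp [ih t ht]
  | x :: v, 0, l => by
    have ih := len_ins a v 0
    rw [ins]; simp only [Finset.mem_image]
    rintro ⟨t, ht, rfl⟩
    simp [ih t ht]
  | x :: v, m + 1, l => by
    have ih := len_ins a v (m + 1)
    have ih2 := len_ins a (x :: v) m
    rw [ins]; simp only [Finset.mem_union, Finset.mem_image]
    rintro (⟨t, ht, rfl⟩ | ⟨t, ht, rfl⟩)
    · simp [ih2 t ht]; omega
    · simp [ih t ht]; omega

/-- refined sums -/
noncomputable def Q (a y : ℕ) (w : List ℕ) (m : ℕ) : Polynomial ℤ :=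
  ∑ l ∈ ins a w m, X ^ mR (y :: l)

lemma Q_aux (a y z : ℕ) (w : List ℕ) (m : ℕ) :
    ∑ l ∈ (ins a w m).image (z :: ·), (X : Polynomial ℤ) ^ mR (y :: l)
      = X ^ (if y < z then w.length + m + 1 else 0) * Q a z w m := by
  rw [Finset.sum_image (by intro p _ q _ h; simpa using h), Q, Finset.mul_sum]
  apply Finset.sum_congr rfl
  intro l hl
  rw [mR, len_ins a w m l hl, pow_add]

lemma Q_nil_zero (a y : ℕ) : Q a y [] 0 = 1 := by simp [Q, ins, mR]

lemma Q_nil_succ (a y m : ℕ) :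
    Q a y [] (m + 1) = X ^ (if y < a then m + 1 else 0) * Q a a [] m := by
  rw [Q, ins, Q_aux]; simp

lemma Q_cons_zero (a y x : ℕ) (v : List ℕ) :
    Q a y (x :: v) 0 = X ^ (if y < x then v.length + 1 else 0) * Q a x v 0 := by
  rw [Q, ins, Q_aux]

lemma Q_cons_succ (a y x : ℕ) (v : List ℕ) (m : ℕ) (h : x ≠ a) :
    Q a y (x :: v) (m + 1) = X ^ (if y < a then v.length + 1 + m + 1 else 0) * Q a a (x :: v) m
      + X ^ (if y < x then v.length + (m + 1) + 1 else 0) * Q a x v (m + 1) := by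
  rw [Q, ins, Finset.sum_union, Q_aux, Q_aux]
  · simp
  · rw [Finset.disjoint_left]
    intro l hl hl2
    simp only [Finset.mem_image] at hl hl2
    obtain ⟨p, _, rfl⟩ := hl
    obtain ⟨q, _, hq⟩ := hl2
    simp at hq
    exact h hq.1

lemma Q_max (a : ℕ) : ∀ (w : List ℕ) (m : ℕ), (∀ x ∈ w, x < a) → ∀ y, y ≤ a →
    Q a y w m = X ^ mR (y :: w) * X ^ (if y < a then m else 0) * gRec w.length m
  | [], 0, _, y, _ => by rw [Q_nil_zero]; simp [mR, gRec_zero_left]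
  | [], m + 1, h, y, hy => by
    rw [Q_nil_succ, Q_max a [] m h a le_rfl]; simp [mR, gRec_zero_left]
  | x :: v, 0, h, y, hy => by
    rw [Q_cons_zero, Q_max a v 0 (by simp at h; exact h.2) x (h x (by simp)).le]
    simp [mR, gRec_zero_right, pow_add]
  | x :: v, m + 1, h, y, hy => by
    have hx : x < a := h x (by simp)
    rw [Q_cons_succ _ _ _ _ _ hx.ne, Q_max a v (m + 1) (by simp at h; exact h.2) x hx.le,
      Q_max a (x :: v) m h a le_rfl]
    simp only [mR, List.length_cons, hx, if_true, hx.not_gt, if_false, lt_irrefl]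
    have p1 := gRec_p1 v.length m
    have p2 := gRec_p2 v.length m
    by_cases h1 : y < a
    · by_cases h2 : y < x
      · simp only [h1, h2, if_true]
        rw [p1]; ring
      · simp only [h1, h2, if_true, if_false]
        rw [p2]; ring
    · have h2 : ¬ y < x := by omega
      simp only [h1, h2, if_false]
      rw [p1]; ring

lemma Q_min (a : ℕ) : ∀ (w : List ℕ) (m : ℕ), (∀ x ∈ w, a < x) → ∀ y, a ≤ y →
    Q a y w m = X ^ mR (y :: w) * gRec w.length m
  | [], 0, _, y, _ => by rw [Q_nil_zero]; simp [mR, gRec_zero_left]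
  | [], m + 1, h, y, hy => by
    rw [Q_nil_succ, Q_min a [] m h a le_rfl]; simp [mR, gRec_zero_left, hy.not_gt]
  | x :: v, 0, h, y, hy => by
    rw [Q_cons_zero, Q_min a v 0 (by simp at h; exact h.2) x (h x (by simp)).le]
    simp [mR, gRec_zero_right, pow_add]
  | x :: v, m + 1, h, y, hy => by
    have hx : a < x := h x (by simp)
    rw [Q_cons_succ _ _ _ _ _ hx.ne', Q_min a v (m + 1) (by simp at h; exact h.2) x hx.le,
      Q_min a (x :: v) m h a le_rfl]
    simp only [mR, List.length_cons, hx, if_true, hy.not_gt, if_false]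
    have p1 := gRec_p1 v.length m
    have p2 := gRec_p2 v.length m
    by_cases h2 : y < x
    · simp only [h2, if_true]
      rw [p1]; ring
    · simp only [h2, if_false]
      rw [p2]; ring

lemma mR_cons_big (y : ℕ) (l : List ℕ) (h : ∀ x ∈ l, x ≤ y) : mR (y :: l) = mR l := by
  cases l with
  | nil => rfl
  | cons x t =>
    rw [mR, if_neg (h x (by simp)).not_gt, zero_add]

lemma sum_S (a m : ℕ) (w : List ℕ) (ha : a ∉ w) (S : Finset (List ℕ))
    (hS : ∀ l : List ℕ, l ∈ S ↔ IsInsertion w a m l) (y : ℕ) (hy : ∀ x ∈ w, x ≤ y) (hay : a ≤ y) :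
    ∑ w' ∈ S, (X : Polynomial ℤ) ^ majW w' = Q a y w.reverse m := by
  have har : a ∉ w.reverse := by simpa using ha
  rw [Q]
  refine Finset.sum_nbij' List.reverse List.reverse ?_ ?_ ?_ ?_ ?_
  · intro l hl
    rw [hS] at hl
    rw [mem_ins _ _ _ har]
    exact ⟨by simpa using hl.2.1, by rw [List.filter_reverse, hl.2.2]⟩
  · intro l hl
    have := len_ins _ _ _ l hl
    rw [mem_ins _ _ _ har] at hl
    rw [hS]
    refine ⟨by simpa using this, by simpa using hl.1, ?_⟩
    rw [List.filter_reverse, hl.2, List.reverse_reverse]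
  · intro l _; simp
  · intro l _; simp
  · intro l hl
    rw [hS] at hl
    rw [mR_cons_big, ← majW_reverse_s7, List.reverse_reverse]
    intro x hx
    by_cases hxa : x = a
    · omega
    · apply hy
      rw [← hl.2.2]
      simpa [hxa] using hx

/-- **Theorem (STATEMENT 7, Lemma 4.6, generating function form).** With `S(w)` the set of
words obtained by inserting `m` copies of the letter `n` into a word `w` of length `k`
all of whose letters are `< n`, `Σ_{w' ∈ S(w)} q^{maj(w')} = q^{maj(w)} [k+m choose m]_q`.
The same holds if all letters of `w` are `> 1` and copies of `1` are inserted. -/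
theorem insertion_maj_genfun (n : ℕ) (hn : 0 < n) (w : List ℕ)
    (hpos : ∀ x ∈ w, 0 < x) (m : ℕ) :
    ((∀ x ∈ w, x < n) →
      ∀ S : Finset (List ℕ), (∀ l : List ℕ, l ∈ S ↔ IsInsertion w n m l) →
        ∑ w' ∈ S, (Polynomial.X : Polynomial ℤ) ^ majW w'
          = Polynomial.X ^ majW w * gaussBinom ((w.length + m : ℕ) : ℤ) m) ∧
    ((∀ x ∈ w, 1 < x) →
      ∀ S : Finset (List ℕ), (∀ l : List ℕ, l ∈ S ↔ IsInsertion w 1 m l) →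
        ∑ w' ∈ S, (Polynomial.X : Polynomial ℤ) ^ majW w'
          = Polynomial.X ^ majW w * gaussBinom ((w.length + m : ℕ) : ℤ) m) := by
  have key : ∀ y, (∀ x ∈ w, x ≤ y) → mR (y :: w.reverse) = majW w := by
    intro y hy
    rw [mR_cons_big _ _ (by simpa using hy), ← majW_reverse_s7, List.reverse_reverse]
  constructor
  · intro h S hS
    rw [sum_S n m w (fun hh => lt_irrefl _ (h n hh)) S hS n (fun x hx => (h x hx).le) le_rfl,
      Q_max n _ _ (by simpa using h) n le_rfl, key n (fun x hx => (h x hx).le), gauss_eq]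
    simp
  · intro h S hS
    have hb : ∀ x ∈ w, x ≤ w.sum + 1 := fun x hx => (List.le_sum_of_mem hx).trans (Nat.le_succ _)
    rw [sum_S 1 m w (fun hh => lt_irrefl _ (h 1 hh)) S hS (w.sum + 1) hb (by omega),
      Q_min 1 _ _ (by simpa using h) (w.sum + 1) (by omega), key _ hb, gauss_eq]
    simp

end MoonPolyomino
end

section
/- Let n be a positive integer, let w = w_1⋯w_k (k ≥ 1) be a word with w_i < n for all i, and for 1 ≤ i ≤ k+1 let w^{(i)} = w_1⋯w_{i−1} n w_i⋯w_k be the word obtained by inserting one copy of n in the i-th gap of w. Then maj(w^{(k+1)}) = maj(w); maj(w^{(1)}) = maj(w) + 1 + des(w); and for 2 ≤ i ≤ k, maj(w^{(i)}) = maj(w) + 1 + des(w_i w_{i+1}⋯w_k) if w_{i−1} > w_i, and maj(w^{(i)}) = maj(w) + i + des(w_i w_{i+1}⋯w_k) if w_{i−1} ≤ w_i. -/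
open Polynomial

namespace MoonPolyomino

theorem getD_ins (w : List ℕ) (n j i : ℕ) (hj : j ≤ w.length) :
    (w.insertIdx j n).getD i 0 =
      if i < j then w.getD i 0 else if i = j then n else w.getD (i - 1) 0 := by
  simp only [List.getD_eq_getElem?_getD, List.getElem?_insertIdx]
  split_ifs <;> simp_all

theorem getD_lt (w : List ℕ) (n i : ℕ) (hn : 0 < n) (hw : ∀ x ∈ w, x < n) :
    w.getD i 0 < n := by
  by_cases h : i < w.length
  · rw [List.getD_eq_getElem _ _ h]; exact hw _ (List.getElem_mem h)
  · rw [List.getD_eq_default _ _ (by omega)]; exact hn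

theorem tail_sum (g : ℕ → ℕ) (c q : ℕ) :
    (∑ t ∈ Finset.range q, if g (t + 1) < g t then c + t + 1 else 0) =
    (∑ t ∈ Finset.range q, if g (t + 1) < g t then c + t else 0) +
      ∑ t ∈ Finset.range q, if g (t + 1) < g t then 1 else 0 := by
  rw [← Finset.sum_add_distrib]
  refine Finset.sum_congr rfl fun t _ => ?_
  split_ifs <;> rfl

theorem ins_last (n : ℕ) (hn : 0 < n) (w : List ℕ) (hk : 0 < w.length)
    (hw : ∀ x ∈ w, x < n) : majW (w.insertIdx w.length n) = majW w := by
  unfold majW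
  rw [List.length_insertIdx_of_le_length le_rfl]
  obtain ⟨p, hp⟩ : ∃ p, w.length = p + 1 := ⟨w.length - 1, by omega⟩
  have h1 : w.length + 1 - 1 = p + 1 := by omega
  have h2 : w.length - 1 = p := by omega
  rw [h1, h2, Finset.sum_range_succ]
  simp only [getD_ins w n _ _ le_rfl]
  have := getD_lt w n p hn hw
  rw [if_neg (by
    rw [if_neg (show ¬ p + 1 < w.length by omega), if_pos hp.symm,
      if_pos (show p < w.length by omega)]
    omega), add_zero]
  refine Finset.sum_congr rfl fun i hi => ?_
  have hi := Finset.mem_range.1 hi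
  rw [if_pos (show i + 1 < w.length by omega), if_pos (show i < w.length by omega)]

theorem ins_first (n : ℕ) (hn : 0 < n) (w : List ℕ) (hk : 0 < w.length)
    (hw : ∀ x ∈ w, x < n) : majW (w.insertIdx 0 n) = majW w + 1 + desW w := by
  unfold majW desW
  rw [List.length_insertIdx_of_le_length (Nat.zero_le _)]
  obtain ⟨p, hp⟩ : ∃ p, w.length = p + 1 := ⟨w.length - 1, by omega⟩
  have h1 : w.length + 1 - 1 = p + 1 := by omega
  have h2 : w.length - 1 = p := by omega
  rw [h1, h2, Finset.sum_range_succ']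
  have h0 := getD_lt w n 0 hn hw
  have ht := tail_sum (fun i => w.getD i 0) 1 p
  simp only [getD_ins w n _ _ (Nat.zero_le _)]
  simp only [Nat.not_lt_zero, if_false, Nat.add_sub_cancel, Nat.add_eq_zero_iff, one_ne_zero,
    and_false, zero_add, if_true, Nat.sub_self, h0]
  simp only [add_comm 1] at ht
  rw [ht]
  omega

theorem ins_mid (n : ℕ) (hn : 0 < n) (w : List ℕ) (p q : ℕ) (hk : w.length = p + 2 + q)
    (hw : ∀ x ∈ w, x < n) :
    majW (w.insertIdx (p + 1) n) + (if w.getD (p + 1) 0 < w.getD p 0 then p + 1 else 0)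
      = majW w + (p + 2) + desW (w.drop (p + 1)) := by
  unfold majW desW
  rw [List.length_insertIdx_of_le_length (by omega), List.length_drop]
  have h1 : w.length + 1 - 1 = p + 1 + 1 + q := by omega
  have h2 : w.length - 1 = p + 1 + q := by omega
  have h3 : w.length - (p + 1) - 1 = q := by omega
  rw [h1, h2, h3, Finset.sum_range_add, Finset.sum_range_succ, Finset.sum_range_succ,
    Finset.sum_range_add, Finset.sum_range_succ]
  simp only [getD_ins w n _ _ (show p + 1 ≤ w.length by omega)]
  have e1 : (∑ i ∈ Finset.range p,
      if (if i + 1 < p + 1 then w.getD (i + 1) 0 else if i + 1 = p + 1 then n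
          else w.getD (i + 1 - 1) 0)
        < (if i < p + 1 then w.getD i 0 else if i = p + 1 then n else w.getD (i - 1) 0)
      then i + 1 else 0)
      = ∑ i ∈ Finset.range p, if w.getD (i + 1) 0 < w.getD i 0 then i + 1 else 0 := by
    refine Finset.sum_congr rfl fun i hi => ?_
    have hi := Finset.mem_range.1 hi
    rw [if_pos (show i + 1 < p + 1 by omega), if_pos (show i < p + 1 by omega)]
  have e2 : (∑ t ∈ Finset.range q,
      if (if p + 1 + 1 + t + 1 < p + 1 then w.getD (p + 1 + 1 + t + 1) 0
          else if p + 1 + 1 + t + 1 = p + 1 then n else w.getD (p + 1 + 1 + t + 1 - 1) 0)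
        < (if p + 1 + 1 + t < p + 1 then w.getD (p + 1 + 1 + t) 0
          else if p + 1 + 1 + t = p + 1 then n else w.getD (p + 1 + 1 + t - 1) 0)
      then p + 1 + 1 + t + 1 else 0)
      = ∑ t ∈ Finset.range q,
        if w.getD (p + 1 + (t + 1)) 0 < w.getD (p + 1 + t) 0 then p + 2 + t + 1 else 0 := by
    refine Finset.sum_congr rfl fun t _ => ?_
    rw [if_neg (show ¬ p + 1 + 1 + t + 1 < p + 1 by omega),
      if_neg (show ¬ p + 1 + 1 + t + 1 = p + 1 by omega),
      if_neg (show ¬ p + 1 + 1 + t < p + 1 by omega),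
      if_neg (show ¬ p + 1 + 1 + t = p + 1 by omega),
      show p + 1 + 1 + t + 1 - 1 = p + 1 + (t + 1) by omega,
      show p + 1 + 1 + t - 1 = p + 1 + t by omega]
  have e3 : (∑ t ∈ Finset.range q,
      if w.getD (p + 1 + t + 1) 0 < w.getD (p + 1 + t) 0 then p + 1 + t + 1 else 0)
      = ∑ t ∈ Finset.range q,
        if w.getD (p + 1 + (t + 1)) 0 < w.getD (p + 1 + t) 0 then p + 2 + t else 0 := by
    refine Finset.sum_congr rfl fun t _ => ?_
    rw [show p + 1 + t + 1 = p + 2 + t by omega, show p + 1 + (t + 1) = p + 2 + t by omega]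
  have e4 : ∀ t, (w.drop (p + 1)).getD t 0 = w.getD (p + 1 + t) 0 := by
    intro t
    simp [List.getD_eq_getElem?_getD, List.getElem?_drop]
  have ht := tail_sum (fun i => w.getD (p + 1 + i) 0) (p + 2) q
  simp only [e4]
  rw [e1, e2, e3, ht]
  have h4 := getD_lt w n p hn hw
  have h5 := getD_lt w n (p + 1) hn hw
  have f1 : ¬ (n < w.getD p 0) := by omega
  simp only [lt_irrefl, if_false, if_true, f1,
    show ¬ (p + 1 + 1 < p + 1) by omega, show ¬ (p + 1 + 1 = p + 1) by omega,
    show p < p + 1 by omega, Nat.add_sub_cancel, h5]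
  omega

/-- **Theorem (STATEMENT 9).** For a nonempty word `w = w₁⋯w_k` of positive integers with
all letters `< n`, and `w⁽ⁱ⁾` the word obtained by inserting one copy of `n` in the `i`-th
gap (in Lean, 0-indexed insertion position `j = i − 1`):
`maj(w⁽ᵏ⁺¹⁾) = maj(w)`; `maj(w⁽¹⁾) = maj(w) + 1 + des(w)`; and for `2 ≤ i ≤ k`,
`maj(w⁽ⁱ⁾) = maj(w) + 1 + des(wᵢ⋯w_k)` if `w_{i−1} > w_i`, while
`maj(w⁽ⁱ⁾) = maj(w) + i + des(wᵢ⋯w_k)` if `w_{i−1} ≤ w_i`. -/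
theorem maj_single_insertion (n : ℕ) (hn : 0 < n) (w : List ℕ)
    (hpos : ∀ x ∈ w, 0 < x) (hk : 0 < w.length) (hw : ∀ x ∈ w, x < n) :
    majW (w.insertIdx w.length n) = majW w ∧
    majW (w.insertIdx 0 n) = majW w + 1 + desW w ∧
    ∀ j : ℕ, 1 ≤ j → j ≤ w.length - 1 →
      (w.getD j 0 < w.getD (j - 1) 0 →
        majW (w.insertIdx j n) = majW w + 1 + desW (w.drop j)) ∧
      (w.getD (j - 1) 0 ≤ w.getD j 0 →
        majW (w.insertIdx j n) = majW w + (j + 1) + desW (w.drop j)) := by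
  refine ⟨ins_last n hn w hk hw, ins_first n hn w hk hw, fun j h1 h2 => ?_⟩
  obtain ⟨p, rfl⟩ : ∃ p, j = p + 1 := ⟨j - 1, by omega⟩
  obtain ⟨q, hq⟩ : ∃ q, w.length = p + 2 + q := ⟨w.length - (p + 2), by omega⟩
  have h := ins_mid n hn w p q hq hw
  rw [Nat.add_sub_cancel]
  constructor
  · intro hd
    rw [if_pos hd] at h
    omega
  · intro hd
    rw [if_neg (by omega)] at h
    omega

end MoonPolyomino
end
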